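/- arXiv:2212.10303 — 2 statements merged into one kernel-verified Lean document; each statement's English description precedes it below -/
import Mathlib

section
/- For a smoothly bounded domain Ω ⊂ ℝ², the Euler characteristic of the ordered configuration space F(Ω,N) = {(x₁,…,x_N) ∈ Ω^N : x_i ≠ x_j for i ≠ j} equals χ(Ω)(χ(Ω)−1)⋯(χ(Ω)−N+1). -/
open CategoryTheory AlgebraicTopology

/-- Rational singular chain complex of a topological space. -/
noncomputable def singularChains (X : Type) [TopologicalSpace X] :
    ChainComplex (ModuleCat ℚ) ℕ :=
  (alternatingFaceMapComplex (ModuleCat ℚ)).obj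
    (TopCat.toSSet.obj (TopCat.of X) ⋙ ModuleCat.free ℚ)

/-- `n`-th rational singular homology of a topological space. -/
noncomputable def singularHomology (X : Type) [TopologicalSpace X] (n : ℕ) : ModuleCat ℚ :=
  (singularChains X).homology n

/-- Euler characteristic: the alternating sum of the ranks of the rational singular
homology groups. -/
noncomputable def eulerChar (X : Type) [TopologicalSpace X] : ℤ :=
  ∑ᶠ n : ℕ, (-1 : ℤ) ^ n * (Module.finrank ℚ (singularHomology X n) : ℤ)

section ChainComplexEuler

open Module Limits

/-- The homology of `K` is finite-dimensional in each degree and vanishes in large degrees. -/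
def FinHomology (K : ChainComplex (ModuleCat.{0} ℚ) ℕ) : Prop :=
  (∀ n, Module.Finite ℚ (K.homology n)) ∧ ∃ N, ∀ n, N ≤ n → finrank ℚ (K.homology n) = 0

/-- The Euler characteristic of the homology of `K`. -/
noncomputable def homEuler (K : ChainComplex (ModuleCat.{0} ℚ) ℕ) : ℤ :=
  ∑ᶠ n : ℕ, (-1 : ℤ) ^ n * (finrank ℚ (K.homology n) : ℤ)

lemma homEuler_eq_sum {K : ChainComplex (ModuleCat.{0} ℚ) ℕ} {N : ℕ}
    (h : ∀ n, N ≤ n → finrank ℚ (K.homology n) = 0) :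
    homEuler K = ∑ n ∈ Finset.range N, (-1 : ℤ) ^ n * (finrank ℚ (K.homology n) : ℤ) := by
  refine finsum_eq_sum_of_support_subset _ fun n hn => ?_
  by_contra hN
  simp only [Finset.coe_range, Set.mem_Iio, not_lt] at hN
  simp [h n hN] at hn

lemma finrank_eq_of_exact {A B C : Type*} [AddCommGroup A] [Module ℚ A] [AddCommGroup B]
    [Module ℚ B] [AddCommGroup C] [Module ℚ C] [Module.Finite ℚ B]
    (f : A →ₗ[ℚ] B) (g : B →ₗ[ℚ] C) (h : LinearMap.range f = LinearMap.ker g) :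
    finrank ℚ B = finrank ℚ (LinearMap.range f) + finrank ℚ (LinearMap.range g) := by
  rw [h, add_comm, LinearMap.finrank_range_add_finrank_ker]

lemma finite_of_exact {A B C : Type*} [AddCommGroup A] [Module ℚ A] [AddCommGroup B]
    [Module ℚ B] [AddCommGroup C] [Module ℚ C] [Module.Finite ℚ A] [Module.Finite ℚ C]
    (f : A →ₗ[ℚ] B) (g : B →ₗ[ℚ] C) (h : LinearMap.range f = LinearMap.ker g) :
    Module.Finite ℚ B :=
  have := isNoetherian_of_range_eq_ker f g h
  inferInstance

lemma finrank_eq_zero_of_exact {A B C : Type*} [AddCommGroup A] [Module ℚ A] [AddCommGroup B]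
    [Module ℚ B] [AddCommGroup C] [Module ℚ C] [Module.Finite ℚ A] [Module.Finite ℚ C]
    (f : A →ₗ[ℚ] B) (g : B →ₗ[ℚ] C) (h : LinearMap.range f = LinearMap.ker g)
    (hA : finrank ℚ A = 0) (hC : finrank ℚ C = 0) :
    finrank ℚ B = 0 := by
  have := finite_of_exact f g h
  rw [finrank_eq_of_exact f g h]
  have h1 := LinearMap.finrank_range_le f
  have h2 := Submodule.finrank_le (LinearMap.range g)
  omega

variable {S : ShortComplex (ChainComplex (ModuleCat.{0} ℚ) ℕ)}

lemma homologyMap_zero_surjective (hS : S.ShortExact) :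
    Function.Surjective (HomologicalComplex.homologyMap S.g 0).hom := by
  have := hS.epi_g
  rw [← ModuleCat.epi_iff_surjective (HomologicalComplex.homologyMap S.g 0)]
  have h2 : IsIso (S.X₂.homologyι 0) := S.X₂.isIso_homologyι 0 _ rfl (by simp)
  have h3 : IsIso (S.X₃.homologyι 0) := S.X₃.isIso_homologyι 0 _ rfl (by simp)
  have : Epi (HomologicalComplex.homologyMap S.g 0 ≫ S.X₃.homologyι 0) := by
    rw [HomologicalComplex.homologyι_naturality]
    infer_instance
  have h : HomologicalComplex.homologyMap S.g 0 =
    (HomologicalComplex.homologyMap S.g 0 ≫ S.X₃.homologyι 0) ≫ inv (S.X₃.homologyι 0) := by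
    rw [Category.assoc, IsIso.hom_inv_id, Category.comp_id]
  rw [h]
  infer_instance

lemma exists_longExact (hS : S.ShortExact) :
    ∃ (f : ∀ n, S.X₁.homology n →ₗ[ℚ] S.X₂.homology n)
      (g : ∀ n, S.X₂.homology n →ₗ[ℚ] S.X₃.homology n)
      (δ : ∀ n, S.X₃.homology (n + 1) →ₗ[ℚ] S.X₁.homology n),
      (∀ n, LinearMap.range (f n) = LinearMap.ker (g n)) ∧
      (∀ n, LinearMap.range (g (n + 1)) = LinearMap.ker (δ n)) ∧
      (∀ n, LinearMap.range (δ n) = LinearMap.ker (f n)) ∧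
      LinearMap.range (g 0) = ⊤ := by
  refine ⟨fun n => (HomologicalComplex.homologyMap S.f n).hom,
    fun n => (HomologicalComplex.homologyMap S.g n).hom,
    fun n => (hS.δ (n + 1) n (by simp)).hom, fun n => ?_, fun n => ?_, fun n => ?_, ?_⟩
  · exact (hS.homology_exact₂ n).moduleCat_range_eq_ker
  · exact (hS.homology_exact₃ (n + 1) n (by simp)).moduleCat_range_eq_ker
  · exact (hS.homology_exact₁ (n + 1) n (by simp)).moduleCat_range_eq_ker
  · exact LinearMap.range_eq_top.2 (homologyMap_zero_surjective hS)

lemma FinHomology.of_shortExact₂ (hS : S.ShortExact) (h₁ : FinHomology S.X₁)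
    (h₃ : FinHomology S.X₃) : FinHomology S.X₂ := by
  obtain ⟨f, g, δ, hf, hg, hδ, h0⟩ := exists_longExact hS
  obtain ⟨f₁, N₁, hN₁⟩ := h₁
  obtain ⟨f₃, N₃, hN₃⟩ := h₃
  exact ⟨fun n => finite_of_exact _ _ (hf n), max N₁ N₃, fun n hn =>
    finrank_eq_zero_of_exact _ _ (hf n) (hN₁ n (by omega)) (hN₃ n (by omega))⟩

lemma FinHomology.of_shortExact₁ (hS : S.ShortExact) (h₂ : FinHomology S.X₂)
    (h₃ : FinHomology S.X₃) : FinHomology S.X₁ := by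
  obtain ⟨f, g, δ, hf, hg, hδ, h0⟩ := exists_longExact hS
  obtain ⟨f₁, N₁, hN₁⟩ := h₂
  obtain ⟨f₃, N₃, hN₃⟩ := h₃
  exact ⟨fun n => finite_of_exact _ _ (hδ n), max N₁ N₃, fun n hn =>
    finrank_eq_zero_of_exact _ _ (hδ n) (hN₃ (n + 1) (by omega)) (hN₁ n (by omega))⟩

lemma FinHomology.of_shortExact₃ (hS : S.ShortExact) (h₁ : FinHomology S.X₁)
    (h₂ : FinHomology S.X₂) : FinHomology S.X₃ := by
  obtain ⟨f, g, δ, hf, hg, hδ, h0⟩ := exists_longExact hS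
  obtain ⟨f₁, N₁, hN₁⟩ := h₁
  obtain ⟨f₂, N₂, hN₂⟩ := h₂
  refine ⟨fun n => ?_, max N₁ N₂ + 1, fun n hn => ?_⟩
  · cases n with
    | zero => exact Module.Finite.of_surjective (g 0) (LinearMap.range_eq_top.1 h0)
    | succ n => exact finite_of_exact _ _ (hg n)
  · obtain ⟨n, rfl⟩ : ∃ m, n = m + 1 := ⟨n - 1, by omega⟩
    exact finrank_eq_zero_of_exact _ _ (hg n) (hN₂ (n + 1) (by omega)) (hN₁ n (by omega))

lemma homEuler_of_shortExact (hS : S.ShortExact) (h₁ : FinHomology S.X₁)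
    (h₂ : FinHomology S.X₂) (h₃ : FinHomology S.X₃) :
    homEuler S.X₂ = homEuler S.X₁ + homEuler S.X₃ := by
  obtain ⟨f, g, δ, hf, hg, hδ, h0⟩ := exists_longExact hS
  obtain ⟨f₁, N₁, hN₁⟩ := h₁
  obtain ⟨f₂, N₂, hN₂⟩ := h₂
  obtain ⟨f₃, N₃, hN₃⟩ := h₃
  set N := max N₁ (max N₂ N₃) with hN
  rw [homEuler_eq_sum (N := N) (fun n hn => hN₁ n (by omega)),
    homEuler_eq_sum (N := N) (fun n hn => hN₂ n (by omega)),
    homEuler_eq_sum (N := N) (fun n hn => hN₃ n (by omega)), ← sub_eq_zero]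
  let r : ℕ → ℤ := fun n => Nat.casesOn n 0 fun m => (finrank ℚ (LinearMap.range (δ m)) : ℤ)
  have key : ∀ n, (finrank ℚ (S.X₂.homology n) : ℤ) =
      finrank ℚ (S.X₁.homology n) - r (n + 1) + (finrank ℚ (S.X₃.homology n) - r n) := by
    intro n
    have e1 := finrank_eq_of_exact _ _ (hδ n)
    have e2 := finrank_eq_of_exact _ _ (hf n)
    have e3 : (finrank ℚ (S.X₃.homology n) : ℤ) = finrank ℚ (LinearMap.range (g n)) + r n := by
      cases n with
      | zero => rw [h0, finrank_top]; simp [r]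
      | succ n =>
        rw [finrank_eq_of_exact _ _ (hg n)]
        push_cast
        rfl
    have e4 : r (n + 1) = (finrank ℚ (LinearMap.range (δ n)) : ℤ) := rfl
    rw [e3, e4, e1, e2]
    push_cast
    ring
  have tel : ∀ M, ∑ n ∈ Finset.range M, (-1 : ℤ) ^ n * (finrank ℚ (S.X₂.homology n) : ℤ) -
      (∑ n ∈ Finset.range M, (-1 : ℤ) ^ n * (finrank ℚ (S.X₁.homology n) : ℤ) +
      ∑ n ∈ Finset.range M, (-1 : ℤ) ^ n * (finrank ℚ (S.X₃.homology n) : ℤ)) =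
      (-1) ^ M * r M := by
    intro M
    induction M with
    | zero => simp [r]
    | succ M ih =>
      rw [Finset.sum_range_succ, Finset.sum_range_succ, Finset.sum_range_succ, key M, pow_succ]
      linear_combination ih
  rw [tel]
  have hr : r N = 0 := by
    rcases hM : N with _ | m
    · rfl
    · have h1 := LinearMap.finrank_range_le (δ m)
      have h2 := hN₃ (m + 1) (by omega)
      simp only [r]
      omega
  rw [hr, mul_zero]

lemma FinHomology.of_iso {K L : ChainComplex (ModuleCat.{0} ℚ) ℕ}
    (e : ∀ n, K.homology n ≅ L.homology n) (h : FinHomology K) : FinHomology L := by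
  obtain ⟨hf, N, hN⟩ := h
  exact ⟨fun n => Module.Finite.equiv (e n).toLinearEquiv, N, fun n hn => by
    rw [← (e n).toLinearEquiv.finrank_eq, hN n hn]⟩

lemma homEuler_congr {K L : ChainComplex (ModuleCat.{0} ℚ) ℕ}
    (e : ∀ n, K.homology n ≅ L.homology n) : homEuler K = homEuler L :=
  finsum_congr fun n => by rw [(e n).toLinearEquiv.finrank_eq]

lemma finHomology_of_isZero {K : ChainComplex (ModuleCat.{0} ℚ) ℕ}
    (h : ∀ n, IsZero (K.homology n)) : FinHomology K ∧ homEuler K = 0 := by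
  have h' n : Subsingleton (K.homology n) := ModuleCat.subsingleton_of_isZero (h n)
  refine ⟨⟨fun n => inferInstance, 0, fun n _ => finrank_zero_of_subsingleton⟩, ?_⟩
  rw [homEuler_eq_sum (N := 0) fun n _ => finrank_zero_of_subsingleton]
  simp

/-- A complex of the form `0 ⟶ K ⟶ L ⟶ X ⟶ Q ⟶ 0` with `Q` acyclic behaves for Euler
characteristics like a short exact sequence. -/
lemma FinHomology.of_acyclic_cokernel {K L X : ChainComplex (ModuleCat.{0} ℚ) ℕ}
    (k : K ⟶ L) (φ : L ⟶ X) (w : k ≫ φ = 0) [Mono k] (hex : (ShortComplex.mk k φ w).Exact)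
    (hQ : ∀ n, IsZero ((cokernel φ).homology n)) (hK : FinHomology K) :
    (FinHomology L ↔ FinHomology X) ∧
      (FinHomology L → homEuler L = homEuler K + homEuler X) := by
  let T := ShortComplex.mk k (cokernel.π k) (cokernel.condition k)
  have hT : T.ShortExact :=
    { exact := ShortComplex.exact_cokernel k
      mono_f := ‹_›
      epi_g := inferInstanceAs (Epi (cokernel.π k)) }
  let i : cokernel k ⟶ X := cokernel.desc k φ w
  have hi : Mono i := hex.mono_cokernelDesc
  have hπ : cokernel.π k ≫ i = φ := cokernel.π_desc _ _ _
  have wi : i ≫ cokernel.π φ = 0 := by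
    rw [← cancel_epi (cokernel.π k), reassoc_of% hπ, cokernel.condition, comp_zero]
  let U := ShortComplex.mk i (cokernel.π φ) wi
  have hU : U.ShortExact :=
    { exact := by
        let V := ShortComplex.mk φ (cokernel.π φ) (cokernel.condition φ)
        let ψ : V ⟶ U := { τ₁ := cokernel.π k, τ₂ := 𝟙 _, τ₃ := 𝟙 _ }
        have : Epi ψ.τ₁ := inferInstanceAs (Epi (cokernel.π k))
        have : IsIso ψ.τ₂ := inferInstanceAs (IsIso (𝟙 _))
        have : Mono ψ.τ₃ := inferInstanceAs (Mono (𝟙 _))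
        exact (ShortComplex.exact_iff_of_epi_of_isIso_of_mono ψ).1 (ShortComplex.exact_cokernel φ)
      mono_f := hi
      epi_g := inferInstanceAs (Epi (cokernel.π φ)) }
  obtain ⟨hQf, hQe⟩ := finHomology_of_isZero hQ
  have h₁ (hL : FinHomology L) : FinHomology (cokernel k) := FinHomology.of_shortExact₃ hT hK hL
  have h₂ (hL : FinHomology L) : FinHomology X := FinHomology.of_shortExact₂ hU (h₁ hL) hQf
  refine ⟨⟨h₂, fun h => ?_⟩, fun hL => ?_⟩
  · exact FinHomology.of_shortExact₂ hT hK (FinHomology.of_shortExact₁ hU h hQf)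
  · have e₁ : homEuler L = homEuler K + homEuler (cokernel k) :=
      homEuler_of_shortExact hT hK hL (h₁ hL)
    have e₂ := homEuler_of_shortExact hU (h₁ hL) (h₂ hL) hQf
    rw [e₁, show homEuler X = homEuler U.X₂ from rfl, e₂, show homEuler U.X₃ = 0 from hQe, add_zero]

end ChainComplexEuler

section ChainMayerVietoris

open Module Limits

lemma finHomology_biprod {K L : ChainComplex (ModuleCat.{0} ℚ) ℕ} (hL : FinHomology L) :
    (FinHomology (K ⊞ L) ↔ FinHomology K) ∧
      (FinHomology K → homEuler (K ⊞ L) = homEuler K + homEuler L) := by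
  let S : ShortComplex (ChainComplex (ModuleCat.{0} ℚ) ℕ) :=
    ShortComplex.mk (biprod.inl : K ⟶ K ⊞ L) biprod.snd biprod.inl_snd
  have hS : S.ShortExact :=
    (ShortComplex.Splitting.ofHasBinaryBiproduct K L).shortExact
  have h₂ (hK : FinHomology K) : FinHomology (K ⊞ L) := FinHomology.of_shortExact₂ hS hK hL
  refine ⟨⟨fun h => FinHomology.of_shortExact₁ hS h hL, h₂⟩, fun h => ?_⟩
  have e := homEuler_of_shortExact hS h (h₂ h) hL
  exact e

lemma isZero_homology_cokernel {L X : ChainComplex (ModuleCat.{0} ℚ) ℕ} (φ : L ⟶ X)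
    (h : ∀ n (x : X.X n), (∀ j, X.d n j x ∈ LinearMap.range (φ.f j).hom) →
      ∃ y : X.X (n + 1), x - X.d (n + 1) n y ∈ LinearMap.range (φ.f n).hom) (n : ℕ) :
    IsZero ((cokernel φ).homology n) := by
  rw [← HomologicalComplex.exactAt_iff_isZero_homology, HomologicalComplex.exactAt_iff' _ (n + 1) n
    ((ComplexShape.down ℕ).next n) (by simp) rfl, ShortComplex.moduleCat_exact_iff]
  have hex : ∀ m, LinearMap.range (φ.f m).hom = LinearMap.ker ((cokernel.π φ).f m).hom := fun m =>
    ((ShortComplex.exact_cokernel φ).map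
      (HomologicalComplex.eval (ModuleCat.{0} ℚ) _ m)).moduleCat_range_eq_ker
  have hπ : ∀ m, Function.Surjective ((cokernel.π φ).f m).hom := fun m =>
    (ModuleCat.epi_iff_surjective ((cokernel.π φ).f m)).1 inferInstance
  have hcomm : ∀ i j (x : X.X i), (cokernel φ).d i j (((cokernel.π φ).f i).hom x) =
      ((cokernel.π φ).f j).hom (X.d i j x) := fun i j x => by
    exact congr(ModuleCat.Hom.hom $((cokernel.π φ).comm i j) x)
  intro q hq
  obtain ⟨x, rfl⟩ := hπ n q
  obtain ⟨y, hy⟩ := h n x fun j => by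
    rw [hex, LinearMap.mem_ker, ← hcomm]
    by_cases hj : (ComplexShape.down ℕ).Rel n j
    · obtain rfl := (ComplexShape.down ℕ).next_eq' hj
      exact hq
    · rw [(cokernel φ).shape _ _ hj]
      simp
  refine ⟨((cokernel.π φ).f (n + 1)).hom y, ?_⟩
  rw [hex, LinearMap.mem_ker, map_sub, sub_eq_zero] at hy
  exact (hcomm _ _ y).trans hy.symm

/-- An elementwise Mayer-Vietoris principle for Euler characteristics of chain complexes. -/
lemma chain_mayerVietoris {K A B X : ChainComplex (ModuleCat.{0} ℚ) ℕ}
    (k : K ⟶ A) (k' : K ⟶ B) (φ : A ⟶ X) (ψ : B ⟶ X) (w : k ≫ φ = k' ≫ ψ)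
    (hk : ∀ n, Function.Injective (k.f n).hom)
    (hex : ∀ n (a : A.X n) (b : B.X n), φ.f n a = ψ.f n b → ∃ c, k.f n c = a ∧ k'.f n c = b)
    (hX : ∀ n (x : X.X n),
      (∀ j, X.d n j x ∈ LinearMap.range (φ.f j).hom ⊔ LinearMap.range (ψ.f j).hom) →
      ∃ y : X.X (n + 1),
        x - X.d (n + 1) n y ∈ LinearMap.range (φ.f n).hom ⊔ LinearMap.range (ψ.f n).hom)
    (hK : FinHomology K) (hB : FinHomology B) :
    (FinHomology A ↔ FinHomology X) ∧
      (FinHomology A → homEuler A + homEuler B = homEuler K + homEuler X) := by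
  let κ : K ⟶ A ⊞ B := biprod.lift k k'
  let θ : A ⊞ B ⟶ X := biprod.desc φ (-ψ)
  have hw : κ ≫ θ = 0 := by simp [κ, θ, biprod.lift_desc, w]
  have hfst : ∀ n (c : K.X n), ((biprod.fst : A ⊞ B ⟶ A).f n).hom ((κ.f n).hom c) =
      (k.f n).hom c := fun n c => by
    exact congr(ModuleCat.Hom.hom (HomologicalComplex.Hom.f $(biprod.lift_fst k k') n) c)
  have hsnd : ∀ n (c : K.X n), ((biprod.snd : A ⊞ B ⟶ B).f n).hom ((κ.f n).hom c) =
      (k'.f n).hom c := fun n c => by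
    exact congr(ModuleCat.Hom.hom (HomologicalComplex.Hom.f $(biprod.lift_snd k k') n) c)
  have htot : ∀ n (z : (A ⊞ B).X n),
      ((biprod.inl : A ⟶ A ⊞ B).f n).hom (((biprod.fst : A ⊞ B ⟶ A).f n).hom z) +
      ((biprod.inr : B ⟶ A ⊞ B).f n).hom (((biprod.snd : A ⊞ B ⟶ B).f n).hom z) = z :=
      fun n z => by
    exact congr(ModuleCat.Hom.hom (HomologicalComplex.Hom.f $(biprod.total (X := A) (Y := B)) n) z)
  have hinl : ∀ n (a : A.X n), (θ.f n).hom (((biprod.inl : A ⟶ A ⊞ B).f n).hom a) =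
      (φ.f n).hom a := fun n a => by
    exact congr(ModuleCat.Hom.hom (HomologicalComplex.Hom.f $(biprod.inl_desc φ (-ψ)) n) a)
  have hinr : ∀ n (b : B.X n), (θ.f n).hom (((biprod.inr : B ⟶ A ⊞ B).f n).hom b) =
      -(ψ.f n).hom b := fun n b => by
    exact congr(ModuleCat.Hom.hom (HomologicalComplex.Hom.f $(biprod.inr_desc φ (-ψ)) n) b)
  have hθ : ∀ n (z : (A ⊞ B).X n), (θ.f n).hom z =
      (φ.f n).hom (((biprod.fst : A ⊞ B ⟶ A).f n).hom z) -
      (ψ.f n).hom (((biprod.snd : A ⊞ B ⟶ B).f n).hom z) := fun n z => by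
    conv_lhs => rw [← htot n z]
    rw [map_add, hinl, hinr, sub_eq_add_neg]
  have hrange : ∀ n, LinearMap.range (θ.f n).hom =
      LinearMap.range (φ.f n).hom ⊔ LinearMap.range (ψ.f n).hom := fun n => by
    refine le_antisymm ?_ (sup_le ?_ ?_)
    · rintro _ ⟨z, rfl⟩
      rw [hθ]
      exact Submodule.sub_mem _ (Submodule.mem_sup_left ⟨_, rfl⟩) (Submodule.mem_sup_right ⟨_, rfl⟩)
    · rintro _ ⟨a, rfl⟩
      exact ⟨_, hinl n a⟩
    · rintro _ ⟨b, rfl⟩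
      exact ⟨((biprod.inr : B ⟶ A ⊞ B).f n).hom (-b), by rw [hinr]; simp⟩
  have hmono : Mono κ := by
    have (n : ℕ) : Mono (κ.f n) := by
      rw [ModuleCat.mono_iff_injective]
      intro c c' h
      apply hk n
      rw [← hfst, ← hfst]
      exact congrArg _ h
    exact HomologicalComplex.mono_of_mono_f κ this
  have hexact : (ShortComplex.mk κ θ hw).Exact := by
    refine HomologicalComplex.exact_of_degreewise_exact _ fun n => ?_
    rw [ShortComplex.moduleCat_exact_iff]
    intro (z : (A ⊞ B).X n) (hz : (θ.f n).hom z = 0)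
    have hz' := hz
    rw [hθ, sub_eq_zero] at hz'
    obtain ⟨c, hc, hc'⟩ := hex n _ _ hz'
    refine ⟨c, ?_⟩
    change (κ.f n).hom c = z
    rw [← htot n ((κ.f n).hom c), hfst, hsnd]
    conv_rhs => rw [← htot n z]
    congr 2
  have hQ := isZero_homology_cokernel θ fun n x hx => by
    obtain ⟨y, hy⟩ := hX n x fun j => by
      rw [← hrange]
      exact hx j
    exact ⟨y, by rwa [hrange]⟩
  obtain ⟨h₁, h₂⟩ := FinHomology.of_acyclic_cokernel κ θ hw hexact hQ hK
  obtain ⟨h₃, h₄⟩ := finHomology_biprod (K := A) hB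
  exact ⟨h₃.symm.trans h₁, fun hA => (h₄ hA).symm.trans (h₂ (h₃.2 hA))⟩

end ChainMayerVietoris

section AffineChains

/-- Rational combinations of `m`-tuples of points of `V`. -/
abbrev TupleChain (V : Type) (m : ℕ) : Type := (Fin m → V) →₀ ℚ

namespace TupleChain

variable {V W : Type}

/-- The alternating sum of the faces. -/
noncomputable def bd (V : Type) (m : ℕ) : TupleChain V (m + 1) →ₗ[ℚ] TupleChain V m :=
  Finsupp.linearCombination ℚ fun v =>
    ∑ i : Fin (m + 1), (-1 : ℚ) ^ (i : ℕ) • Finsupp.single (v ∘ i.succAbove) 1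

/-- The cone with apex `b`. -/
noncomputable def cone (b : V) (m : ℕ) : TupleChain V m →ₗ[ℚ] TupleChain V (m + 1) :=
  Finsupp.lmapDomain ℚ ℚ fun v => Fin.cons b v

/-- The chain map induced by a map of points. -/
noncomputable def push (f : V → W) (m : ℕ) : TupleChain V m →ₗ[ℚ] TupleChain W m :=
  Finsupp.lmapDomain ℚ ℚ fun v => f ∘ v

lemma bd_single {m : ℕ} (v : Fin (m + 1) → V) : bd V m (Finsupp.single v 1) =
    ∑ i : Fin (m + 1), (-1 : ℚ) ^ (i : ℕ) • Finsupp.single (v ∘ i.succAbove) 1 := by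
  simp [bd]

lemma cone_single (b : V) {m : ℕ} (v : Fin m → V) :
    cone b m (Finsupp.single v 1) = Finsupp.single (Fin.cons b v : Fin (m + 1) → V) 1 := by
  simp [cone, Finsupp.mapDomain_single]

lemma push_single (f : V → W) {m : ℕ} (v : Fin m → V) :
    push f m (Finsupp.single v 1) = Finsupp.single (f ∘ v) 1 := by
  simp [push, Finsupp.mapDomain_single]

lemma bd_cone_zero (b : V) (c : TupleChain V 0) : bd V 0 (cone b 0 c) = c := by
  induction c using Finsupp.induction_linear with
  | zero => simp
  | add x y hx hy => simp [map_add, hx, hy]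
  | single v q =>
    rw [← mul_one q, ← smul_eq_mul, ← Finsupp.smul_single, map_smul, map_smul, cone_single,
      bd_single]
    rw [Fin.sum_univ_succ, Subsingleton.elim ((Fin.cons b v : Fin 1 → V) ∘ Fin.succAbove 0) v]
    simp

lemma cons_comp_succAbove_succ (b : V) {m : ℕ} (v : Fin (m + 1) → V) (i : Fin (m + 1)) :
    (Fin.cons b v : Fin (m + 2) → V) ∘ i.succ.succAbove = Fin.cons b (v ∘ i.succAbove) := by
  funext j
  refine Fin.cases ?_ (fun j => ?_) j <;> simp

lemma bd_cone (b : V) {m : ℕ} (c : TupleChain V (m + 1)) :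
    bd V (m + 1) (cone b (m + 1) c) = c - cone b m (bd V m c) := by
  induction c using Finsupp.induction_linear with
  | zero => simp
  | add x y hx hy => simp only [map_add, hx, hy]; abel
  | single v q =>
    rw [← mul_one q, ← smul_eq_mul, ← Finsupp.smul_single]
    simp only [map_smul, cone_single, bd_single, ← smul_sub]
    congr 1
    rw [Fin.sum_univ_succ, map_sum, sub_eq_add_neg, ← Finset.sum_neg_distrib]
    congr 1
    · simp
    · refine Finset.sum_congr rfl fun i _ => ?_
      rw [cons_comp_succAbove_succ, map_smul, cone_single]
      simp [pow_succ]

lemma bd_bd {m : ℕ} (c : TupleChain V (m + 2)) : bd V m (bd V (m + 1) c) = 0 := by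
  induction m with
  | zero =>
    induction c using Finsupp.induction_linear with
    | zero => simp
    | add x y hx hy => simp only [map_add, hx, hy, add_zero]
    | single v q =>
      rw [← mul_one q, ← smul_eq_mul, ← Finsupp.smul_single, ← Fin.cons_self_tail v, ← cone_single]
      simp only [map_smul, bd_cone, map_sub, bd_cone_zero, sub_self, smul_zero]
  | succ m ih =>
    induction c using Finsupp.induction_linear with
    | zero => simp
    | add x y hx hy => simp only [map_add, hx, hy, add_zero]
    | single v q =>
      rw [← mul_one q, ← smul_eq_mul, ← Finsupp.smul_single, ← Fin.cons_self_tail v, ← cone_single]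
      simp only [map_smul, bd_cone, map_sub, ih, map_zero, sub_zero, sub_self, smul_zero]

lemma bd_push (f : V → W) {m : ℕ} (c : TupleChain V (m + 1)) :
    bd W m (push f (m + 1) c) = push f m (bd V m c) := by
  induction c using Finsupp.induction_linear with
  | zero => simp
  | add x y hx hy => simp only [map_add, hx, hy]
  | single v q =>
    rw [← mul_one q, ← smul_eq_mul, ← Finsupp.smul_single]
    simp only [map_smul, push_single, bd_single, map_sum]
    rfl

lemma push_cone (f : V → W) (b : V) {m : ℕ} (c : TupleChain V m) :
    push f (m + 1) (cone b m c) = cone (f b) m (push f m c) := by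
  induction c using Finsupp.induction_linear with
  | zero => simp
  | add x y hx hy => simp only [map_add, hx, hy]
  | single v q =>
    rw [← mul_one q, ← smul_eq_mul, ← Finsupp.smul_single]
    simp only [map_smul, push_single, cone_single]
    congr 2
    funext j
    refine Fin.cases ?_ (fun j => ?_) j <;> simp

/-- Barycentric subdivision, relative to a choice `β` of barycentres. -/
noncomputable def sd (β : ∀ m, (Fin (m + 1) → V) → V) :
    ∀ m, TupleChain V m →ₗ[ℚ] TupleChain V m
  | 0 => LinearMap.id
  | m + 1 => Finsupp.linearCombination ℚ fun v =>
      cone (β m v) m (sd β m (bd V m (Finsupp.single v 1)))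

/-- The homotopy between barycentric subdivision and the identity. -/
noncomputable def sdHtpy (β : ∀ m, (Fin (m + 1) → V) → V) :
    ∀ m, TupleChain V m →ₗ[ℚ] TupleChain V (m + 1)
  | 0 => 0
  | m + 1 => Finsupp.linearCombination ℚ fun v =>
      cone (β m v) (m + 1)
        (Finsupp.single v 1 - sdHtpy β m (bd V m (Finsupp.single v 1)))

variable (β : ∀ m, (Fin (m + 1) → V) → V) (γ : ∀ m, (Fin (m + 1) → W) → W)

lemma sd_single {m : ℕ} (v : Fin (m + 1) → V) : sd β (m + 1) (Finsupp.single v 1) =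
    cone (β m v) m (sd β m (bd V m (Finsupp.single v 1))) := by
  simp [sd]

lemma sdHtpy_single {m : ℕ} (v : Fin (m + 1) → V) : sdHtpy β (m + 1) (Finsupp.single v 1) =
    cone (β m v) (m + 1)
        (Finsupp.single v 1 - sdHtpy β m (bd V m (Finsupp.single v 1))) := by
  simp [sdHtpy]

lemma bd_sdHtpy {m : ℕ} (c : TupleChain V (m + 1)) :
    bd V (m + 1) (sdHtpy β (m + 1) c) + sdHtpy β m (bd V m c) = c - sd β (m + 1) c := by
  induction m with
  | zero =>
    induction c using Finsupp.induction_linear with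
    | zero => simp
    | add x y hx hy =>
      simp only [map_add]
      rw [add_sub_add_comm, ← hx, ← hy]; abel
    | single v q =>
      rw [← mul_one q, ← smul_eq_mul, ← Finsupp.smul_single]
      simp only [map_smul, sdHtpy_single, bd_cone, ← smul_sub, ← smul_add, sd_single]
      simp [sdHtpy, sd]
  | succ m ih =>
    induction c using Finsupp.induction_linear with
    | zero => simp
    | add x y hx hy =>
      simp only [map_add]
      rw [add_sub_add_comm, ← hx, ← hy]; abel
    | single v q =>
      rw [← mul_one q, ← smul_eq_mul, ← Finsupp.smul_single]
      simp only [map_smul, ← smul_sub, ← smul_add]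
      rw [sdHtpy_single, bd_cone, sd_single]
      have h := ih (bd V (m + 1) (Finsupp.single v 1))
      rw [bd_bd, map_zero, add_zero] at h
      rw [map_sub (bd V (m + 1)), h]
      congr 1
      simp only [map_sub]
      abel

lemma bd_sd {m : ℕ} (c : TupleChain V (m + 2)) :
    bd V (m + 1) (sd β (m + 2) c) = sd β (m + 1) (bd V (m + 1) c) := by
  have h := congrArg (bd V (m + 1)) (bd_sdHtpy β c)
  have h' := bd_sdHtpy β (bd V (m + 1) c)
  rw [bd_bd, map_zero, add_zero] at h'
  rw [map_add, bd_bd, zero_add, map_sub, h'] at h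
  simpa using h.symm

variable {β γ} {f : V → W}

lemma push_sd (h : ∀ m v, f (β m v) = γ m (f ∘ v)) {m : ℕ} (c : TupleChain V m) :
    push f m (sd β m c) = sd γ m (push f m c) := by
  induction m with
  | zero => rfl
  | succ m ih =>
    induction c using Finsupp.induction_linear with
    | zero => simp
    | add x y hx hy => simp only [map_add, hx, hy]
    | single v q =>
      rw [← mul_one q, ← smul_eq_mul, ← Finsupp.smul_single]
      simp only [map_smul, sd_single, push_cone, ih, h, ← bd_push, push_single]

lemma push_sdHtpy (h : ∀ m v, f (β m v) = γ m (f ∘ v)) {m : ℕ} (c : TupleChain V m) :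
    push f (m + 1) (sdHtpy β m c) = sdHtpy γ m (push f m c) := by
  induction m with
  | zero => simp [sdHtpy]
  | succ m ih =>
    induction c using Finsupp.induction_linear with
    | zero => simp
    | add x y hx hy => simp only [map_add, hx, hy]
    | single v q =>
      rw [← mul_one q, ← smul_eq_mul, ← Finsupp.smul_single]
      simp only [map_smul, sdHtpy_single, push_cone, ih, h, ← bd_push, push_single, map_sub]

end TupleChain

end AffineChains

section StandardSimplex

/-- The standard `n`-simplex. -/
abbrev Simp (n : ℕ) : Type := stdSimplex ℝ (Fin (n + 1))

namespace Simp

variable {m n p : ℕ}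

/-- The convex combination of the points `v i` with weights `t i`. -/
noncomputable def comb (t : Simp m) (v : Fin (m + 1) → Simp n) : Simp n :=
  ⟨fun j => ∑ i, t.1 i * (v i).1 j,
    fun j => Finset.sum_nonneg fun i _ => mul_nonneg (t.2.1 i) ((v i).2.1 j), by
      rw [Finset.sum_comm]
      simp only [← Finset.mul_sum, (v _).2.2, mul_one, t.2.2]⟩

lemma comb_coe (t : Simp m) (v : Fin (m + 1) → Simp n) :
    (comb t v).1 = ∑ i, t.1 i • (v i).1 := by
  funext j
  simp [comb]

lemma comb_comb (t : Simp m) (v : Fin (m + 1) → Simp n) (w : Fin (n + 1) → Simp p) :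
    comb (comb t v) w = comb t (fun i => comb (v i) w) := by
  apply Subtype.ext
  funext k
  simp only [comb, Finset.sum_mul, Finset.mul_sum]
  rw [Finset.sum_comm]
  simp only [mul_assoc]

/-- The `i`-th vertex. -/
noncomputable def vtx (n : ℕ) (i : Fin (n + 1)) : Simp n :=
  ⟨Pi.single i 1, single_mem_stdSimplex ℝ i⟩

lemma comb_vtx (t : Simp n) : comb t (vtx n) = t := by
  apply Subtype.ext
  funext k
  simp [comb, vtx, Pi.single_apply]

lemma vtx_comb (i : Fin (m + 1)) (v : Fin (m + 1) → Simp n) : comb (vtx m i) v = v i := by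
  apply Subtype.ext
  funext k
  simp [comb, vtx, Pi.single_apply]

/-- The barycentre of a tuple of points. -/
noncomputable def bary (n m : ℕ) (v : Fin (m + 1) → Simp n) : Simp n :=
  comb stdSimplex.barycenter v

lemma comb_bary (v : Fin (m + 1) → Simp n) (w : Fin (n + 1) → Simp p) :
    comb (bary n m v) w = bary p m ((fun x => comb x w) ∘ v) :=
  comb_comb _ _ _

/-- The affine map with prescribed values on the vertices. -/
noncomputable def aff (v : Fin (m + 1) → Simp n) : C(Simp m, Simp n) :=
  ⟨fun t => comb t v, by
    refine Continuous.subtype_mk (continuous_pi fun j => ?_) _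
    refine continuous_finsetSum _ fun i _ => ?_
    exact ((continuous_apply i).comp continuous_subtype_val).mul continuous_const⟩

@[simp] lemma aff_apply (v : Fin (m + 1) → Simp n) (t : Simp m) : aff v t = comb t v := rfl

lemma aff_vtx : aff (vtx n) = ContinuousMap.id _ := by
  ext1 t
  exact comb_vtx t

lemma aff_comp (v : Fin (m + 1) → Simp n) (w : Fin (n + 1) → Simp p) :
    (aff w).comp (aff v) = aff ((fun x => comb x w) ∘ v) := by
  ext1 t
  exact comb_comb _ _ _

/-- The inclusion of the `i`-th face. -/
noncomputable def face (i : Fin (n + 2)) : C(Simp n, Simp (n + 1)) :=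
  ⟨_, stdSimplex.continuous_map i.succAbove⟩

lemma face_eq (i : Fin (n + 2)) : face i = aff (vtx (n + 1) ∘ i.succAbove) := by
  ext1 t
  apply Subtype.ext
  funext j
  simp only [face, aff, comb, ContinuousMap.coe_mk, vtx, Function.comp_apply]
  change (stdSimplex.map i.succAbove t : Fin (n + 2) → ℝ) j = _
  simp [stdSimplex.map_coe, FunOnFinite.linearMap_apply_apply, Pi.single_apply, Finset.sum_filter,
    eq_comm]
  rfl

lemma comb_dist_le {r : ℝ} (x : Simp n) (t : Simp m) (v : Fin (m + 1) → Simp n)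
    (h : ∀ i, dist (v i) x ≤ r) : dist (comb t v) x ≤ r := by
  have : (comb t v).1 ∈ Metric.closedBall x.1 r := by
    rw [comb_coe]
    exact (convex_closedBall x.1 r).sum_mem (fun i _ => t.2.1 i) t.2.2 fun i _ => h i
  exact this

lemma bary_dist_le {r : ℝ} (v : Fin (m + 1) → Simp n) (k : Fin (m + 1))
    (h : ∀ i, dist (v i) (v k) ≤ r) : dist (bary n m v) (v k) ≤ m / (m + 1) * r := by
  have e : (bary n m v).1 - (v k).1 = (1 / (m + 1 : ℝ)) • ∑ i ∈ Finset.univ.erase k,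
      ((v i).1 - (v k).1) := by
    have hm : (m + 1 : ℝ) ≠ 0 := by positivity
    rw [bary, comb_coe, Finset.sum_erase _ (sub_self _), Finset.sum_sub_distrib, smul_sub,
      Finset.smul_sum]
    simp only [stdSimplex.barycenter_apply, Fintype.card_fin, Finset.sum_const, Finset.card_univ,
      one_div, ← Nat.cast_smul_eq_nsmul ℝ, smul_smul]
    push_cast
    rw [inv_mul_cancel₀ hm, one_smul]
  change dist (bary n m v).1 (v k).1 ≤ _
  rw [dist_eq_norm, e, norm_smul]
  have : ‖∑ i ∈ Finset.univ.erase k, ((v i).1 - (v k).1)‖ ≤ m * r := by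
    refine (norm_sum_le_of_le (n := fun _ => r) _ fun i _ => ?_).trans ?_
    · rw [← dist_eq_norm]; exact h i
    · simp
  rw [Real.norm_of_nonneg (by positivity), div_mul_eq_mul_div, div_mul_eq_mul_div, one_mul]
  gcongr

open TupleChain in
lemma cone_mem_supported {V : Type} {b : V} {s : Set (Fin m → V)} {s' : Set (Fin (m + 1) → V)}
    (h : ∀ u ∈ s, (Fin.cons b u : Fin (m + 1) → V) ∈ s') {c : TupleChain V m}
    (hc : c ∈ Finsupp.supported ℚ ℚ s) : cone b m c ∈ Finsupp.supported ℚ ℚ s' := by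
  classical
  rw [Finsupp.mem_supported] at hc ⊢
  intro w hw
  obtain ⟨u, hu, rfl⟩ := Finset.mem_image.1 (Finsupp.mapDomain_support hw)
  exact h u (hc hu)

open TupleChain in
lemma sd_mem_supported {m : ℕ} {r : ℝ} (hr : 0 ≤ r) (v : Fin (m + 1) → Simp n)
    (h : ∀ i j, dist (v i) (v j) ≤ r) :
    sd (bary n) (m + 1) (Finsupp.single v 1) ∈ Finsupp.supported ℚ ℚ
      {w | (∀ j, ∃ t : Simp m, w j = comb t v) ∧ ∀ i j, dist (w i) (w j) ≤ m / (m + 1) * r} := by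
  induction m with
  | zero =>
    rw [sd_single]
    refine cone_mem_supported (s := Set.univ) ?_ (by simp)
    refine fun u _ => ⟨fun j => ⟨stdSimplex.barycenter, ?_⟩, fun i j => ?_⟩
    · rw [Subsingleton.elim (α := Fin 1) j 0]; rfl
    · rw [Subsingleton.elim (α := Fin 1) i j]; simp
  | succ m ih =>
    rw [sd_single, bd_single, map_sum, map_sum]
    refine Submodule.sum_mem _ fun i _ => ?_
    rw [map_smul, map_smul]
    refine Submodule.smul_mem _ _ (cone_mem_supported ?_
      (ih (v ∘ i.succAbove) fun _ _ => h _ _))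
    rintro u ⟨hu, hd⟩
    have hu' : ∀ j, ∃ t : Simp (m + 1), u j = comb t v := by
      intro j
      obtain ⟨t, ht⟩ := hu j
      refine ⟨comb t (vtx (m + 1) ∘ i.succAbove), ?_⟩
      rw [ht, comb_comb]
      congr 1
      funext k
      exact (vtx_comb (i.succAbove k) v).symm
    have hb : ∀ j, dist (u j) (bary n (m + 1) v) ≤ ((m + 1 : ℕ) : ℝ) / ((m + 1 : ℕ) + 1) * r := by
      intro j
      obtain ⟨t, ht⟩ := hu' j
      rw [ht]
      refine comb_dist_le _ _ _ fun k => ?_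
      rw [dist_comm]
      exact bary_dist_le v k fun i => h i k
    have hmr : (m : ℝ) / (m + 1) * r ≤ ((m + 1 : ℕ) : ℝ) / ((m + 1 : ℕ) + 1) * r := by
      refine mul_le_mul_of_nonneg_right ?_ hr
      push_cast
      rw [div_le_div_iff₀ (by positivity) (by positivity)]
      nlinarith
    refine ⟨fun j => ?_, fun j k => ?_⟩
    · refine Fin.cases ⟨_, rfl⟩ (fun j => ?_) j
      simpa using hu' j
    · refine Fin.cases ?_ (fun j => ?_) j <;> refine Fin.cases ?_ (fun k => ?_) k
      · simp only [dist_self]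
        positivity
      · simpa [dist_comm] using hb k
      · simpa using hb j
      · simpa using (hd j k).trans hmr

open TupleChain in
lemma sd_iterate_mem_supported {m : ℕ} {r : ℝ} (hr : 0 ≤ r) (v : Fin (m + 1) → Simp n)
    (h : ∀ i j, dist (v i) (v j) ≤ r) (k : ℕ) :
    (sd (bary n) (m + 1))^[k] (Finsupp.single v 1) ∈ Finsupp.supported ℚ ℚ
      {w | ∀ i j, dist (w i) (w j) ≤ (m / (m + 1)) ^ k * r} := by
  have key : ∀ k, Finsupp.supported ℚ ℚ
      {w : Fin (m + 1) → Simp n | ∀ i j, dist (w i) (w j) ≤ (m / (m + 1)) ^ k * r} ≤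
      (Finsupp.supported ℚ ℚ
      {w : Fin (m + 1) → Simp n | ∀ i j, dist (w i) (w j) ≤ (m / (m + 1)) ^ (k + 1) * r}).comap
      (sd (bary n) (m + 1)) := by
    intro k
    rw [Finsupp.supported_eq_span_single, Submodule.span_le]
    rintro _ ⟨w, hw, rfl⟩
    refine Finsupp.supported_mono ?_ (sd_mem_supported (by positivity) w hw)
    rintro u ⟨-, hu⟩
    refine fun i j => (hu i j).trans (le_of_eq ?_)
    ring
  induction k with
  | zero => simpa [Finsupp.mem_supported, Finsupp.support_single] using h
  | succ k ih =>
    rw [Function.iterate_succ_apply']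
    exact key k ih

end Simp

end StandardSimplex

section SingularSubdivision

/-- Singular `n`-chains with rational coefficients. -/
abbrev SingChain (X : Type) [TopologicalSpace X] (n : ℕ) : Type := C(Simp n, X) →₀ ℚ

namespace SingChain

open TupleChain Simp

variable {X : Type} [TopologicalSpace X] {n m p : ℕ}

/-- The boundary map on singular chains. -/
noncomputable def d (X : Type) [TopologicalSpace X] (n : ℕ) :
    SingChain X (n + 1) →ₗ[ℚ] SingChain X n :=
  Finsupp.linearCombination ℚ fun σ =>
    ∑ i : Fin (n + 2), (-1 : ℚ) ^ (i : ℕ) • Finsupp.single (σ.comp (face i)) 1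

lemma d_single (σ : C(Simp (n + 1), X)) : d X n (Finsupp.single σ 1) =
    ∑ i : Fin (n + 2), (-1 : ℚ) ^ (i : ℕ) • Finsupp.single (σ.comp (face i)) 1 := by
  simp [d]

/-- The singular chain obtained by restricting `σ` to affine simplices. -/
noncomputable def real (σ : C(Simp n, X)) (m : ℕ) :
    TupleChain (Simp n) (m + 1) →ₗ[ℚ] SingChain X m :=
  Finsupp.lmapDomain ℚ ℚ fun v => σ.comp (aff v)

lemma real_single (σ : C(Simp n, X)) (v : Fin (m + 1) → Simp n) :
    real σ m (Finsupp.single v 1) = Finsupp.single (σ.comp (aff v)) 1 := by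
  simp [real, Finsupp.mapDomain_single]

lemma real_vtx (σ : C(Simp n, X)) :
    real σ n (Finsupp.single (vtx n) 1) = Finsupp.single σ 1 := by
  rw [real_single, aff_vtx, ContinuousMap.comp_id]

lemma real_comp_aff (σ : C(Simp n, X)) (v : Fin (p + 1) → Simp n)
    (c : TupleChain (Simp p) (m + 1)) :
    real (σ.comp (aff v)) m c = real σ m (push (fun x => comb x v) (m + 1) c) := by
  induction c using Finsupp.induction_linear with
  | zero => simp
  | add x y hx hy => simp only [map_add, hx, hy]
  | single w q =>
    rw [← mul_one q, ← smul_eq_mul, ← Finsupp.smul_single]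
    simp only [map_smul, real_single, push_single, ContinuousMap.comp_assoc, aff_comp]

lemma d_real (σ : C(Simp n, X)) (c : TupleChain (Simp n) (m + 2)) :
    d X m (real σ (m + 1) c) = real σ m (bd _ (m + 1) c) := by
  induction c using Finsupp.induction_linear with
  | zero => simp
  | add x y hx hy => simp only [map_add, hx, hy]
  | single w q =>
    rw [← mul_one q, ← smul_eq_mul, ← Finsupp.smul_single]
    simp only [map_smul, real_single, bd_single, d_single, map_sum, face_eq,
      ContinuousMap.comp_assoc, aff_comp]
    congr 1
    refine Finset.sum_congr rfl fun i _ => ?_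
    congr 4
    funext j
    exact vtx_comb (i.succAbove j) w

/-- Barycentric subdivision of singular chains. -/
noncomputable def sds (X : Type) [TopologicalSpace X] (n : ℕ) :
    SingChain X n →ₗ[ℚ] SingChain X n :=
  Finsupp.linearCombination ℚ fun σ =>
    real σ n (sd (bary n) (n + 1) (Finsupp.single (vtx n) 1))

/-- The homotopy between the barycentric subdivision of singular chains and the identity. -/
noncomputable def htpy (X : Type) [TopologicalSpace X] (n : ℕ) :
    SingChain X n →ₗ[ℚ] SingChain X (n + 1) :=
  Finsupp.linearCombination ℚ fun σ =>
    real σ (n + 1) (sdHtpy (bary n) (n + 1) (Finsupp.single (vtx n) 1))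

lemma push_vtx (v : Fin (m + 1) → Simp n) : push (fun x => comb x v) (m + 1)
    (Finsupp.single (vtx m) 1) = Finsupp.single v 1 := by
  rw [push_single]
  congr 1
  funext i
  exact vtx_comb i v

lemma sds_real (σ : C(Simp n, X)) (c : TupleChain (Simp n) (m + 1)) :
    sds X m (real σ m c) = real σ m (sd (bary n) (m + 1) c) := by
  induction c using Finsupp.induction_linear with
  | zero => simp
  | add x y hx hy => simp only [map_add, hx, hy]
  | single w q =>
    rw [← mul_one q, ← smul_eq_mul, ← Finsupp.smul_single]
    simp only [map_smul, real_single]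
    rw [sds, Finsupp.linearCombination_single, one_smul, real_comp_aff,
      push_sd (γ := bary n) (fun m v => comb_bary v w), push_vtx]

lemma htpy_real (σ : C(Simp n, X)) (c : TupleChain (Simp n) (m + 1)) :
    htpy X m (real σ m c) = real σ (m + 1) (sdHtpy (bary n) (m + 1) c) := by
  induction c using Finsupp.induction_linear with
  | zero => simp
  | add x y hx hy => simp only [map_add, hx, hy]
  | single w q =>
    rw [← mul_one q, ← smul_eq_mul, ← Finsupp.smul_single]
    simp only [map_smul, real_single]
    rw [htpy, Finsupp.linearCombination_single, one_smul, real_comp_aff,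
      push_sdHtpy (γ := bary n) (fun m v => comb_bary v w), push_vtx]

lemma d_htpy (c : SingChain X (n + 1)) :
    d X (n + 1) (htpy X (n + 1) c) + htpy X n (d X n c) = c - sds X (n + 1) c := by
  induction c using Finsupp.induction_linear with
  | zero => simp
  | add x y hx hy => simp only [map_add]; rw [add_sub_add_comm, ← hx, ← hy]; abel
  | single σ q =>
    rw [← mul_one q, ← smul_eq_mul, ← Finsupp.smul_single, ← real_vtx]
    simp only [map_smul, d_real, htpy_real, sds_real]
    rw [← smul_add, ← smul_sub, ← map_add, ← map_sub, bd_sdHtpy]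

lemma d_sds (c : SingChain X (n + 1)) : d X n (sds X (n + 1) c) = sds X n (d X n c) := by
  induction c using Finsupp.induction_linear with
  | zero => simp
  | add x y hx hy => simp only [map_add, hx, hy]
  | single σ q =>
    rw [← mul_one q, ← smul_eq_mul, ← Finsupp.smul_single, ← real_vtx]
    simp only [map_smul, d_real, sds_real, bd_sd]

/-- The chains all of whose simplices lie in `U` or in `V`. -/
noncomputable def small (U V : Set X) (n : ℕ) : Submodule ℚ (SingChain X n) :=
  Finsupp.supported ℚ ℚ {σ | Set.range σ ⊆ U ∨ Set.range σ ⊆ V}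

variable {U V : Set X}

lemma real_mem_small {σ : C(Simp n, X)} (h : Set.range σ ⊆ U ∨ Set.range σ ⊆ V)
    (c : TupleChain (Simp n) (m + 1)) : real σ m c ∈ small U V m := by
  have h' (v : Fin (m + 1) → Simp n) : Set.range (σ.comp (aff v)) ⊆ Set.range σ := by
    rintro _ ⟨x, rfl⟩
    exact ⟨_, rfl⟩
  induction c using Finsupp.induction_linear with
  | zero => simp
  | add x y hx hy => rw [map_add]; exact add_mem hx hy
  | single v q =>
    rw [← mul_one q, ← smul_eq_mul, ← Finsupp.smul_single, map_smul, real_single]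
    exact Submodule.smul_mem _ _ (Finsupp.single_mem_supported _ _
      (h.imp (h' v).trans (h' v).trans))

lemma linearCombination_mem_small {f : C(Simp n, X) → SingChain X m}
    (hf : ∀ σ : C(Simp n, X), Set.range σ ⊆ U ∨ Set.range σ ⊆ V → f σ ∈ small U V m)
    {c : SingChain X n} (hc : c ∈ small U V n) :
    Finsupp.linearCombination ℚ f c ∈ small U V m := by
  suffices small U V n ≤ (small U V m).comap (Finsupp.linearCombination ℚ f) from this hc
  rw [small, Finsupp.supported_eq_span_single, Submodule.span_le]
  rintro _ ⟨σ, hσ, rfl⟩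
  simpa using hf σ hσ

lemma sds_mem_small {c : SingChain X n} (hc : c ∈ small U V n) : sds X n c ∈ small U V n :=
  linearCombination_mem_small (fun _ h => real_mem_small h _) hc

lemma htpy_mem_small {c : SingChain X n} (hc : c ∈ small U V n) :
    htpy X n c ∈ small U V (n + 1) :=
  linearCombination_mem_small (fun _ h => real_mem_small h _) hc

lemma sds_iterate_mem_small {c : SingChain X n} (hc : c ∈ small U V n) (k : ℕ) :
    (sds X n)^[k] c ∈ small U V n := by
  induction k with
  | zero => exact hc
  | succ k ih => rw [Function.iterate_succ_apply']; exact sds_mem_small ih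

lemma exists_sds_iterate_single_mem_small (hU : IsOpen U) (hV : IsOpen V)
    (hUV : U ∪ V = Set.univ) (σ : C(Simp n, X)) :
    ∃ k, (sds X n)^[k] (Finsupp.single σ 1) ∈ small U V n := by
  obtain ⟨δ, hδ, hL⟩ := lebesgue_number_lemma_of_metric (s := (Set.univ : Set (Simp n)))
    isCompact_univ (c := fun b : Bool => σ ⁻¹' (if b then U else V))
    (by rintro (_ | _) <;> simp <;> [exact hV.preimage σ.2; exact hU.preimage σ.2])
    (by
      intro x _
      have : σ x ∈ U ∪ V := hUV ▸ trivial
      rw [Set.mem_iUnion]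
      exact this.elim (fun h => ⟨true, by simpa using h⟩) (fun h => ⟨false, by simpa using h⟩))
  have hlt : (n / (n + 1) : ℝ) < 1 := by
    rw [div_lt_one (by positivity)]; linarith
  set r := Metric.diam (Set.univ : Set (Simp n))
  have hr : 0 ≤ r := Metric.diam_nonneg
  have hlim : Filter.Tendsto (fun k : ℕ => (n / (n + 1) : ℝ) ^ k * r) Filter.atTop (nhds 0) := by
    simpa using (tendsto_pow_atTop_nhds_zero_of_lt_one (by positivity) hlt).mul_const r
  obtain ⟨k, hk⟩ := (hlim.eventually (gt_mem_nhds hδ)).exists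
  refine ⟨k, ?_⟩
  have hit : (sds X n)^[k] (Finsupp.single σ 1) =
      real σ n ((sd (bary n) (n + 1))^[k] (Finsupp.single (vtx n) 1)) := by
    rw [← real_vtx]
    exact ((Function.Semiconj.iterate_right (f := real σ n) (fun c => (sds_real σ c).symm) k)
      _).symm
  rw [hit]
  have hs := sd_iterate_mem_supported hr (vtx n) (fun i j => Metric.dist_le_diam_of_mem
    isCompact_univ.isBounded trivial trivial) k
  generalize (sd (bary n) (n + 1))^[k] (Finsupp.single (vtx n) 1) = c at hs
  suffices Finsupp.supported ℚ ℚ _ ≤ (small U V n).comap (real σ n) from this hs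
  rw [Finsupp.supported_eq_span_single, Submodule.span_le]
  rintro _ ⟨w, hw, rfl⟩
  simp only [Submodule.comap_coe, Set.mem_preimage, real_single, SetLike.mem_coe]
  refine Finsupp.single_mem_supported _ _ ?_
  obtain ⟨b, hb⟩ := hL (w 0) trivial
  have hsub : ∀ t, comb t w ∈ Metric.ball (w 0) δ := fun t =>
    (comb_dist_le _ _ _ fun i => hw i 0).trans_lt hk
  cases b
  · right
    rintro _ ⟨t, rfl⟩
    simpa using hb (hsub t)
  · left
    rintro _ ⟨t, rfl⟩
    simpa using hb (hsub t)

lemma exists_sds_iterate_mem_small (hU : IsOpen U) (hV : IsOpen V)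
    (hUV : U ∪ V = Set.univ) (c : SingChain X n) :
    ∃ k, (sds X n)^[k] c ∈ small U V n := by
  suffices ∃ k, ∀ l, k ≤ l → (sds X n ^ l) c ∈ small U V n by
    obtain ⟨k, hk⟩ := this
    exact ⟨k, by simpa [Module.End.pow_apply] using hk k le_rfl⟩
  induction c using Finsupp.induction_linear with
  | zero => exact ⟨0, by simp⟩
  | add x y hx hy =>
    obtain ⟨k, hk⟩ := hx
    obtain ⟨l, hl⟩ := hy
    refine ⟨max k l, fun j hj => ?_⟩
    rw [map_add]
    exact add_mem (hk _ (le_trans (le_max_left _ _) hj)) (hl _ (le_trans (le_max_right _ _) hj))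
  | single σ q =>
    obtain ⟨k, hk⟩ := exists_sds_iterate_single_mem_small hU hV hUV σ
    refine ⟨k, fun l hl => ?_⟩
    rw [← mul_one q, ← smul_eq_mul, ← Finsupp.smul_single, map_smul]
    obtain ⟨j, rfl⟩ := Nat.exists_eq_add_of_le' hl
    rw [Module.End.pow_apply, Function.iterate_add_apply]
    exact Submodule.smul_mem _ _ (sds_iterate_mem_small hk j)

/-- A chain with small boundary is homologous to a small chain. -/
lemma exists_sub_d_mem_small (hU : IsOpen U) (hV : IsOpen V)
    (hUV : U ∪ V = Set.univ) (c : SingChain X (n + 1)) (hc : d X n c ∈ small U V n) :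
    ∃ y, c - d X (n + 1) y ∈ small U V (n + 1) := by
  obtain ⟨k, hk⟩ := exists_sds_iterate_mem_small hU hV hUV c
  induction k generalizing c with
  | zero => exact ⟨0, by simpa using hk⟩
  | succ k ih =>
    obtain ⟨y, hy⟩ := ih (sds X _ c) (by rw [d_sds]; exact sds_mem_small hc) hk
    refine ⟨y + htpy X (n + 1) c, ?_⟩
    have e : c - d X (n + 1) (y + htpy X (n + 1) c) =
        (sds X _ c - d X (n + 1) y) + htpy X n (d X n c) := by
      have h := d_htpy c
      rw [map_add, ← sub_eq_zero]
      rw [← sub_eq_zero] at h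
      rw [← neg_eq_zero, ← h]
      abel
    rw [e]
    exact add_mem hy (htpy_mem_small hc)

lemma mem_small_zero (hUV : U ∪ V = Set.univ) (c : SingChain X 0) : c ∈ small U V 0 := by
  refine fun σ _ => ?_
  have : σ default ∈ U ∪ V := hUV ▸ trivial
  refine this.imp ?_ ?_ <;>
  · rintro h _ ⟨x, rfl⟩
    rwa [Subsingleton.elim x default]

end SingChain

end SingularSubdivision

section SingularChains

open Simplicial Opposite Simp

namespace SingChain

variable {X Y Z : Type} [TopologicalSpace X] [TopologicalSpace Y] [TopologicalSpace Z]

/-- The chain map induced by a continuous map. -/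
noncomputable def chMap (f : C(X, Y)) : singularChains X ⟶ singularChains Y :=
  (alternatingFaceMapComplex (ModuleCat.{0} ℚ)).map
    (Functor.whiskerRight (TopCat.toSSet.map (TopCat.ofHom f)) (ModuleCat.free ℚ))

lemma chMap_id : chMap (ContinuousMap.id X) = 𝟙 _ := by
  rw [chMap, TopCat.ofHom_id, CategoryTheory.Functor.map_id, Functor.whiskerRight_id']
  exact CategoryTheory.Functor.map_id _ _

lemma chMap_comp (f : C(X, Y)) (g : C(Y, Z)) : chMap (g.comp f) = chMap f ≫ chMap g := by
  rw [chMap, TopCat.ofHom_comp, Functor.map_comp, Functor.whiskerRight_comp]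
  exact Functor.map_comp _ _ _

/-- Identification of the terms of the singular complex with formal combinations of continuous
maps. -/
noncomputable def eqv (X : Type) [TopologicalSpace X] (n : ℕ) :
    (singularChains X).X n ≃ₗ[ℚ] SingChain X n :=
  Finsupp.domLCongr (TopCat.toSSetObjEquiv (TopCat.of X) (op ⦋n⦌))

/-- The generator of the singular complex attached to a singular simplex. -/
noncomputable def gen {n : ℕ} (σ : C(Simp n, X)) : (singularChains X).X n :=
  ModuleCat.freeMk ((TopCat.toSSetObjEquiv (TopCat.of X) (op ⦋n⦌)).symm σ)

lemma eqv_gen {n : ℕ} (σ : C(Simp n, X)) : eqv X n (gen σ) = Finsupp.single σ 1 :=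
  (Finsupp.domLCongr_single _ _ _).trans (by rw [Equiv.apply_symm_apply])

lemma eqv_symm_single {n : ℕ} (σ : C(Simp n, X)) :
    (eqv X n).symm (Finsupp.single σ 1) = gen σ := by
  rw [LinearEquiv.symm_apply_eq, eqv_gen]

lemma alternating_sum_hom_apply {M N : ModuleCat.{0} ℚ} {k : ℕ} (f : Fin k → (M ⟶ N)) (x : M) :
    (∑ i : Fin k, (-1 : ℤ) ^ (i : ℕ) • f i).hom x =
      ∑ i : Fin k, (-1 : ℚ) ^ (i : ℕ) • (f i).hom x := by
  rw [ModuleCat.hom_sum, LinearMap.sum_apply]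
  refine Finset.sum_congr rfl fun i _ => ?_
  rw [ModuleCat.hom_zsmul, LinearMap.smul_apply, ← Int.cast_smul_eq_zsmul ℚ]
  simp

lemma d_gen {n : ℕ} (σ : C(Simp (n + 1), X)) : (singularChains X).d (n + 1) n (gen σ) =
    ∑ i : Fin (n + 2), (-1 : ℚ) ^ (i : ℕ) • gen (σ.comp (face i)) := by
  have e : (singularChains X).d (n + 1) n =
      AlternatingFaceMapComplex.objD (TopCat.toSSet.obj (TopCat.of X) ⋙ ModuleCat.free ℚ) n :=
    alternatingFaceMapComplex_obj_d _ _
  refine congr(ModuleCat.Hom.hom $e (gen σ)).trans ((alternating_sum_hom_apply _ _).trans ?_)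
  refine Finset.sum_congr rfl fun i _ => congrArg _ ?_
  exact ModuleCat.free_map_apply _ _

lemma chMap_gen (f : C(X, Y)) {n : ℕ} (σ : C(Simp n, X)) :
    (chMap f).f n (gen σ) = gen (f.comp σ) :=
  ModuleCat.free_map_apply _ _

lemma eqv_d {n : ℕ} (x : (singularChains X).X (n + 1)) :
    eqv X n ((singularChains X).d (n + 1) n x) = d X n (eqv X (n + 1) x) := by
  obtain ⟨x, rfl⟩ := (eqv X (n + 1)).symm.surjective x
  rw [LinearEquiv.apply_symm_apply]
  induction x using Finsupp.induction_linear with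
  | zero => simp
  | add x y hx hy => simp only [map_add, hx, hy]
  | single σ q =>
    rw [← mul_one q, ← smul_eq_mul, ← Finsupp.smul_single]
    simp only [map_smul, eqv_symm_single, d_single, d_gen, map_sum, eqv_gen]

lemma eqv_chMap (f : C(X, Y)) {n : ℕ} (x : (singularChains X).X n) :
    eqv Y n ((chMap f).f n x) = Finsupp.lmapDomain ℚ ℚ (fun σ => f.comp σ) (eqv X n x) := by
  obtain ⟨x, rfl⟩ := (eqv X n).symm.surjective x
  rw [LinearEquiv.apply_symm_apply]
  induction x using Finsupp.induction_linear with
  | zero => simp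
  | add x y hx hy => simp only [map_add, hx, hy]
  | single σ q =>
    rw [← mul_one q, ← smul_eq_mul, ← Finsupp.smul_single]
    simp only [map_smul, eqv_symm_single, chMap_gen, eqv_gen, Finsupp.lmapDomain_apply,
      Finsupp.mapDomain_single]

end SingChain

end SingularChains

section MayerVietoris

open Topology SingChain

/-- The singular homology of `X` is finite-dimensional in total. -/
def HasFinHomology (X : Type) [TopologicalSpace X] : Prop := FinHomology (singularChains X)

variable {X Y K A B : Type} [TopologicalSpace X] [TopologicalSpace Y] [TopologicalSpace K]
  [TopologicalSpace A] [TopologicalSpace B]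

lemma Topology.IsEmbedding.exists_comp_eq {i : C(A, X)} (hi : IsEmbedding i) (σ : C(Y, X))
    (h : Set.range σ ⊆ Set.range i) : ∃ τ : C(Y, A), i.comp τ = σ := by
  choose τ hτ using fun y => h ⟨y, rfl⟩
  refine ⟨⟨τ, hi.continuous_iff.2 ?_⟩, ContinuousMap.ext hτ⟩
  convert σ.2
  exact funext hτ

lemma mem_range_chMap_iff {i : C(A, X)} (hi : IsEmbedding i) {n : ℕ}
    (x : (singularChains X).X n) : x ∈ LinearMap.range ((chMap i).f n).hom ↔
      eqv X n x ∈ Finsupp.supported ℚ ℚ {σ : C(Simp n, X) | Set.range σ ⊆ Set.range i} := by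
  have himg : {σ : C(Simp n, X) | Set.range σ ⊆ Set.range i} =
      (fun τ : C(Simp n, A) => i.comp τ) '' Set.univ := by
    ext σ
    refine ⟨fun h => ?_, ?_⟩
    · obtain ⟨τ, rfl⟩ := hi.exists_comp_eq σ h
      exact ⟨τ, trivial, rfl⟩
    · rintro ⟨τ, -, rfl⟩ _ ⟨y, rfl⟩
      exact ⟨_, rfl⟩
  rw [himg, ← Finsupp.lmapDomain_supported, Finsupp.supported_univ]
  refine ⟨?_, ?_⟩
  · rintro ⟨a, rfl⟩
    exact ⟨eqv A n a, trivial, (eqv_chMap i a).symm⟩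
  · rintro ⟨a, -, h⟩
    refine ⟨(eqv A n).symm a, (eqv X n).injective ?_⟩
    rw [← h]
    refine (eqv_chMap i _).trans ?_
    rw [LinearEquiv.apply_symm_apply]

lemma chMap_injective {i : C(A, X)} (hi : Function.Injective i) (n : ℕ) :
    Function.Injective ((chMap i).f n).hom := by
  intro a b h
  apply (eqv A n).injective
  have h' := congrArg (eqv X n) h
  have e := ((eqv_chMap i a).symm.trans h').trans (eqv_chMap i b)
  refine Finsupp.mapDomain_injective ?_ e
  intro σ τ hστ
  ext y
  exact hi (DFunLike.congr_fun hστ y)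

/-- The Mayer–Vietoris principle for Euler characteristics. -/
lemma mayerVietoris {kA : C(K, A)} {kB : C(K, B)} {iA : C(A, X)} {iB : C(B, X)}
    (w : iA.comp kA = iB.comp kB) (hA : IsOpenEmbedding iA) (hB : IsOpenEmbedding iB)
    (hK : IsEmbedding (iA.comp kA))
    (hr : Set.range iA ∩ Set.range iB ⊆ Set.range (iA.comp kA))
    (hu : Set.range iA ∪ Set.range iB = Set.univ)
    (finK : HasFinHomology K) (finB : HasFinHomology B) :
    (HasFinHomology A ↔ HasFinHomology X) ∧
      (HasFinHomology A → eulerChar A + eulerChar B = eulerChar K + eulerChar X) := by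
  refine chain_mayerVietoris (chMap kA) (chMap kB) (chMap iA) (chMap iB) ?_ ?_ ?_ ?_ finK finB
  · rw [← chMap_comp, ← chMap_comp, w]
  · refine chMap_injective fun x y h => hK.injective ?_
    simp only [ContinuousMap.comp_apply, h]
  · intro n a b hab
    have h1 : (chMap iA).f n a ∈ LinearMap.range ((chMap iA).f n).hom := ⟨a, rfl⟩
    have h2 : (chMap iA).f n a ∈ LinearMap.range ((chMap iB).f n).hom := ⟨b, hab.symm⟩
    rw [mem_range_chMap_iff hA.isEmbedding] at h1
    rw [mem_range_chMap_iff hB.isEmbedding] at h2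
    have h3 : (chMap iA).f n a ∈ LinearMap.range ((chMap (iA.comp kA)).f n).hom := by
      rw [mem_range_chMap_iff hK]
      intro σ hσ
      exact (Set.subset_inter (h1 hσ) (h2 hσ)).trans hr
    obtain ⟨c, hc⟩ := h3
    refine ⟨c, ?_, ?_⟩
    · apply chMap_injective hA.injective n
      refine Eq.trans ?_ hc
      rw [chMap_comp]
      rfl
    · apply chMap_injective hB.injective n
      refine Eq.trans ?_ (hc.trans hab)
      rw [w, chMap_comp]
      rfl
  · have key : ∀ n (x : (singularChains X).X n),
        x ∈ LinearMap.range ((chMap iA).f n).hom ⊔ LinearMap.range ((chMap iB).f n).hom ↔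
        eqv X n x ∈ small (Set.range iA) (Set.range iB) n := by
      intro n x
      have h1 : LinearMap.range ((chMap iA).f n).hom =
          (Finsupp.supported ℚ ℚ {σ : C(Simp n, X) | Set.range σ ⊆ Set.range iA}).comap
            (eqv X n).toLinearMap :=
        Submodule.ext fun x => mem_range_chMap_iff hA.isEmbedding x
      have h2 : LinearMap.range ((chMap iB).f n).hom =
          (Finsupp.supported ℚ ℚ {σ : C(Simp n, X) | Set.range σ ⊆ Set.range iB}).comap
            (eqv X n).toLinearMap :=
        Submodule.ext fun x => mem_range_chMap_iff hB.isEmbedding x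
      have h3 : small (Set.range iA) (Set.range iB) n =
          Finsupp.supported ℚ ℚ {σ : C(Simp n, X) | Set.range σ ⊆ Set.range iA} ⊔
          Finsupp.supported ℚ ℚ {σ : C(Simp n, X) | Set.range σ ⊆ Set.range iB} := by
        rw [← Finsupp.supported_union]; rfl
      rw [h1, h2, h3]
      exact ((Submodule.orderIsoMapComap (eqv X n)).symm.map_sup _ _).symm ▸ Iff.rfl
    rintro (_ | n) x hx
    · exact ⟨0, (key 0 _).2 (mem_small_zero hu _)⟩
    · have hx' : d X n (eqv X (n + 1) x) ∈ small (Set.range iA) (Set.range iB) n := by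
        rw [← eqv_d, ← key]
        exact hx n
      obtain ⟨y, hy⟩ := exists_sub_d_mem_small hA.isOpen_range hB.isOpen_range hu _ hx'
      refine ⟨(eqv X (n + 2)).symm y, (key _ _).2 ?_⟩
      rw [map_sub, eqv_d, LinearEquiv.apply_symm_apply]
      exact hy

end MayerVietoris

section HomotopyInvariance

open SingChain Limits ContinuousMap

variable {X Y : Type} [TopologicalSpace X] [TopologicalSpace Y]

lemma homologyMap_chMap_eq {f g : C(X, Y)} (h : f.Homotopic g) (n : ℕ) :
    HomologicalComplex.homologyMap (chMap f) n = HomologicalComplex.homologyMap (chMap g) n := by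
  obtain ⟨H⟩ := h
  have H' : TopCat.Homotopy (TopCat.ofHom f) (TopCat.ofHom g) := H
  exact ((H'.toSSet.toSimplicialObjectHomotopy.whiskerRight
    (ModuleCat.free.{0} ℚ)).toChainHomotopy).homologyMap_eq n

/-- Homotopy equivalent spaces have isomorphic homology. -/
noncomputable def homologyIsoOfHomotopyEquiv (e : X ≃ₕ Y) (n : ℕ) :
    (singularChains X).homology n ≅ (singularChains Y).homology n where
  hom := HomologicalComplex.homologyMap (chMap e.toFun) n
  inv := HomologicalComplex.homologyMap (chMap e.invFun) n
  hom_inv_id := by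
    rw [← HomologicalComplex.homologyMap_comp, ← chMap_comp, homologyMap_chMap_eq e.left_inv,
      chMap_id, HomologicalComplex.homologyMap_id]
  inv_hom_id := by
    rw [← HomologicalComplex.homologyMap_comp, ← chMap_comp, homologyMap_chMap_eq e.right_inv,
      chMap_id, HomologicalComplex.homologyMap_id]

lemma HasFinHomology.of_homotopyEquiv (e : X ≃ₕ Y) (h : HasFinHomology Y) : HasFinHomology X :=
  FinHomology.of_iso (fun n => (homologyIsoOfHomotopyEquiv e n).symm) h

lemma eulerChar_congr (e : X ≃ₕ Y) : eulerChar X = eulerChar Y :=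
  homEuler_congr (homologyIsoOfHomotopyEquiv e)

/-- The singular complex of a totally disconnected space. -/
noncomputable def singularChainsIsoOfTotallyDisconnected (X : Type) [TopologicalSpace X]
    [TotallyDisconnectedSpace X] : singularChains X ≅
      ChainComplex.alternatingConst.obj (ModuleCat.of ℚ (X →₀ ℚ)) :=
  (alternatingFaceMapComplex _).mapIso
    (((SimplicialObject.whiskering _ _).obj (ModuleCat.free ℚ)).mapIso
    (TopCat.toSSetIsoConst (TopCat.of X)) ≪≫ Functor.constComp _ _ _) ≪≫
    alternatingFaceMapComplexConst.app _

lemma finrank_homology_of_totallyDisconnected [TotallyDisconnectedSpace X] [Finite X] (n : ℕ) :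
    Module.Finite ℚ ((singularChains X).homology n) ∧
    Module.finrank ℚ ((singularChains X).homology n) = if n = 0 then Nat.card X else 0 := by
  have : Fintype X := Fintype.ofFinite X
  let e := HomologicalComplex.homologyMapIso (singularChainsIsoOfTotallyDisconnected X) n
  split_ifs with hn
  · subst hn
    let e' := (e ≪≫ ChainComplex.alternatingConstHomologyZero _).toLinearEquiv
    exact ⟨Module.Finite.equiv e'.symm, by
      rw [e'.finrank_eq]
      change Module.finrank ℚ (X →₀ ℚ) = _
      simp⟩
  · have hz : IsZero ((singularChains X).homology n) :=
      (ChainComplex.alternatingConst_exactAt _ _ hn).isZero_homology.of_iso e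
    have := ModuleCat.subsingleton_of_isZero hz
    exact ⟨inferInstance, Module.finrank_zero_of_subsingleton⟩

lemma HasFinHomology.of_totallyDisconnected [TotallyDisconnectedSpace X] [Finite X] :
    HasFinHomology X :=
  ⟨fun n => (finrank_homology_of_totallyDisconnected n).1, 1, fun n hn => by
    rw [(finrank_homology_of_totallyDisconnected n).2, if_neg (by omega)]⟩

lemma eulerChar_of_totallyDisconnected [TotallyDisconnectedSpace X] [Finite X] :
    eulerChar X = Nat.card X := by
  refine (homEuler_eq_sum (N := 1) fun n hn => ?_).trans ?_
  · rw [(finrank_homology_of_totallyDisconnected n).2, if_neg (by omega)]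
  · simp [(finrank_homology_of_totallyDisconnected (X := X) 0).2]

end HomotopyInvariance

section Multiplicative

open ContinuousMap Topology

variable {X Y K A B E : Type} [TopologicalSpace X] [TopologicalSpace Y] [TopologicalSpace K]
  [TopologicalSpace A] [TopologicalSpace B] [TopologicalSpace E]

lemma eulerChar_unit : eulerChar Unit = 1 := by
  simp [eulerChar_of_totallyDisconnected]

/-- The Euler characteristic is multiplicative on products with `Z`. -/
def IsEulerMultiplicative (Z : Type) [TopologicalSpace Z] : Prop :=
  ∀ (Y : Type) [TopologicalSpace Y], HasFinHomology Y →
    HasFinHomology (Y × Z) ∧ eulerChar (Y × Z) = eulerChar Y * eulerChar Z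

namespace IsEulerMultiplicative

lemma hasFinHomology (h : IsEulerMultiplicative X) : HasFinHomology X :=
  .of_homotopyEquiv (Homeomorph.punitProd X).symm.toHomotopyEquiv
    (h PUnit .of_totallyDisconnected).1

lemma of_homotopyEquiv (e : X ≃ₕ Y) (h : IsEulerMultiplicative Y) : IsEulerMultiplicative X := by
  intro Z _ hZ
  have e' : Z × X ≃ₕ Z × Y := (ContinuousMap.HomotopyEquiv.refl Z).prodCongr e
  exact ⟨.of_homotopyEquiv e' (h Z hZ).1, by rw [eulerChar_congr e', eulerChar_congr e, (h Z hZ).2]⟩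

lemma unit : IsEulerMultiplicative Unit := by
  intro Z _ hZ
  have e' : Z × Unit ≃ₕ Z := (Homeomorph.prodPUnit Z).toHomotopyEquiv
  exact ⟨.of_homotopyEquiv e' hZ, by rw [eulerChar_congr e', eulerChar_unit, mul_one]⟩

lemma of_contractible [ContractibleSpace X] : IsEulerMultiplicative X :=
  of_homotopyEquiv (ContractibleSpace.hequiv X Unit).some unit

lemma of_isEmpty [IsEmpty X] : IsEulerMultiplicative X := by
  intro Z _ hZ
  exact ⟨.of_totallyDisconnected, by simp [eulerChar_of_totallyDisconnected]⟩

lemma mayerVietoris {kA : C(K, A)} {kB : C(K, B)} {iA : C(A, X)} {iB : C(B, X)}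
    (w : iA.comp kA = iB.comp kB) (hA : IsOpenEmbedding iA) (hB : IsOpenEmbedding iB)
    (hK : IsEmbedding (iA.comp kA))
    (hr : Set.range iA ∩ Set.range iB ⊆ Set.range (iA.comp kA))
    (hu : Set.range iA ∪ Set.range iB = Set.univ)
    (mK : IsEulerMultiplicative K) (mA : IsEulerMultiplicative A) (mB : IsEulerMultiplicative B) :
    IsEulerMultiplicative X := by
  intro Z _ hZ
  have h1 := _root_.mayerVietoris w hA hB hK hr hu mK.hasFinHomology mB.hasFinHomology
  have h2 := _root_.mayerVietoris (kA := (ContinuousMap.id Z).prodMap kA)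
    (kB := (ContinuousMap.id Z).prodMap kB) (iA := (ContinuousMap.id Z).prodMap iA)
    (iB := (ContinuousMap.id Z).prodMap iB)
    (by ext1 x; exact Prod.ext rfl (DFunLike.congr_fun w x.2))
    (IsOpenEmbedding.id.prodMap hA) (IsOpenEmbedding.id.prodMap hB)
    (IsEmbedding.id.prodMap hK)
    (by
      rintro ⟨z, x⟩ ⟨⟨a, ha⟩, ⟨b, hb⟩⟩
      obtain ⟨k, hk⟩ := hr ⟨⟨a.2, congrArg Prod.snd ha⟩, ⟨b.2, congrArg Prod.snd hb⟩⟩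
      exact ⟨(z, k), Prod.ext rfl hk⟩)
    (by
      refine Set.eq_univ_of_forall fun ⟨z, x⟩ => ?_
      have hx : x ∈ Set.range iA ∪ Set.range iB := hu ▸ trivial
      refine hx.imp ?_ ?_ <;>
      · rintro ⟨a, rfl⟩
        exact ⟨(z, a), rfl⟩)
    (mK Z hZ).1 (mB Z hZ).1
  have e1 := h1.2 mA.hasFinHomology
  have e2 := h2.2 (mA Z hZ).1
  rw [(mK Z hZ).2, (mB Z hZ).2, (mA Z hZ).2] at e2
  refine ⟨h2.1.1 (mA Z hZ).1, ?_⟩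
  linear_combination (eulerChar Z) * e1 - e2

end IsEulerMultiplicative

section Union

variable {S T : Set E}

lemma isOpenEmbedding_inclusion (hS : IsOpen S) (h : S ⊆ T) :
    IsOpenEmbedding (Set.inclusion h) :=
  ⟨IsEmbedding.inclusion h, by
    rw [Set.range_inclusion]; exact hS.preimage continuous_subtype_val⟩

/-- The inclusion of subsets as a continuous map. -/
def inclMap (h : S ⊆ T) : C(S, T) := ⟨Set.inclusion h, continuous_inclusion h⟩

lemma range_inclMap_inter :
    Set.range (inclMap (Set.subset_union_left : S ⊆ S ∪ T)) ∩
      Set.range (inclMap (Set.subset_union_right : T ⊆ S ∪ T)) ⊆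
    Set.range ((inclMap Set.subset_union_left).comp
      (inclMap (Set.inter_subset_left : S ∩ T ⊆ S)) : C(↥(S ∩ T), ↥(S ∪ T))) := by
  rintro x ⟨⟨a, rfl⟩, ⟨b, hb⟩⟩
  have : b.1 = a.1 := congrArg Subtype.val hb
  exact ⟨⟨a.1, a.2, this ▸ b.2⟩, rfl⟩

lemma range_inclMap_union :
    Set.range (inclMap (Set.subset_union_left : S ⊆ S ∪ T)) ∪
      Set.range (inclMap (Set.subset_union_right : T ⊆ S ∪ T)) = Set.univ := by
  refine Set.eq_univ_of_forall fun ⟨x, hx⟩ => ?_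
  exact hx.imp (fun h => ⟨⟨x, h⟩, rfl⟩) (fun h => ⟨⟨x, h⟩, rfl⟩)

lemma mayerVietoris_union (hS : IsOpen S) (hT : IsOpen T)
    (fin : HasFinHomology ↥(S ∩ T)) (finT : HasFinHomology T) :
    (HasFinHomology S ↔ HasFinHomology ↥(S ∪ T)) ∧
      (HasFinHomology S →
        eulerChar S + eulerChar T = eulerChar ↥(S ∩ T) + eulerChar ↥(S ∪ T)) := by
  refine mayerVietoris (kA := inclMap Set.inter_subset_left)
    (kB := inclMap Set.inter_subset_right) (iA := inclMap Set.subset_union_left)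
    (iB := inclMap Set.subset_union_right) rfl (isOpenEmbedding_inclusion hS Set.subset_union_left)
    (isOpenEmbedding_inclusion hT Set.subset_union_right)
    (IsEmbedding.inclusion (Set.inter_subset_left.trans Set.subset_union_left))
    range_inclMap_inter range_inclMap_union fin finT

lemma IsEulerMultiplicative.union (hS : IsOpen S) (hT : IsOpen T)
    (m : IsEulerMultiplicative ↥(S ∩ T)) (mS : IsEulerMultiplicative S)
    (mT : IsEulerMultiplicative T) : IsEulerMultiplicative ↥(S ∪ T) := by
  refine .mayerVietoris (kA := inclMap Set.inter_subset_left)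
    (kB := inclMap Set.inter_subset_right) (iA := inclMap Set.subset_union_left)
    (iB := inclMap Set.subset_union_right) rfl (isOpenEmbedding_inclusion hS Set.subset_union_left)
    (isOpenEmbedding_inclusion hT Set.subset_union_right)
    (IsEmbedding.inclusion (Set.inter_subset_left.trans Set.subset_union_left))
    range_inclMap_inter range_inclMap_union m mS mT

/-- A finite union of members of an intersection-stable family of open sets on which the Euler
characteristic is multiplicative. -/
lemma IsEulerMultiplicative.iUnion {G : Set (Set E)} (ho : ∀ U ∈ G, IsOpen U)
    (hi : ∀ U ∈ G, ∀ V ∈ G, U ∩ V ∈ G) (hm : ∀ U ∈ G, IsEulerMultiplicative U)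
    (n : ℕ) (f : Fin n → Set E) (hf : ∀ i, f i ∈ G) : IsEulerMultiplicative ↥(⋃ i, f i) := by
  induction n with
  | zero =>
    have : IsEmpty ↥(⋃ i, f i) := by simp
    exact .of_isEmpty
  | succ n ih =>
    have e : ⋃ i, f i = f 0 ∪ ⋃ i : Fin n, f i.succ := by
      ext x; simp [Fin.exists_fin_succ]
    rw [e]
    refine .union (ho _ (hf _)) (isOpen_iUnion fun i => ho _ (hf _)) ?_ (hm _ (hf _))
      (ih _ fun i => hf _)
    rw [Set.inter_iUnion]
    exact ih _ fun i => hi _ (hf _) _ (hf _)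

end Union

end Multiplicative

section GoodCover

open ContinuousMap Topology

variable {E : Type} [NormedAddCommGroup E] [InnerProductSpace ℝ E]

/-- The parabolic arc from `p` to `q` bent in the direction `e`. -/
noncomputable def arc (e p q : E) (t : ℝ) : E :=
  ((1 - t) • p + t • q) + (t * (1 - t) * ‖p - q‖ ^ 2) • e

lemma arc_zero (e p q : E) : arc e p q 0 = p := by simp [arc]

lemma arc_one (e p q : E) : arc e p q 1 = q := by simp [arc]

lemma continuous_arc (e q : E) : Continuous fun x : ℝ × E => arc e x.2 q x.1 := by
  unfold arc; fun_prop

lemma norm_sq_segment (a b : E) (t : ℝ) :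
    ‖(1 - t) • a + t • b‖ ^ 2 =
      (1 - t) * ‖a‖ ^ 2 + t * ‖b‖ ^ 2 - t * (1 - t) * ‖a - b‖ ^ 2 := by
  rw [norm_add_sq_real, norm_sub_sq_real, norm_smul, norm_smul, real_inner_smul_left,
    real_inner_smul_right, mul_pow, mul_pow, Real.norm_eq_abs, Real.norm_eq_abs, sq_abs, sq_abs]
  ring

lemma arc_mem_ball {c p q e : E} {R t : ℝ} (hp : p ∈ Metric.ball c R) (hq : q ∈ Metric.ball c R)
    (he : R * ‖e‖ ≤ 1 / 3) (ht : t ∈ Set.Icc (0 : ℝ) 1) : arc e p q t ∈ Metric.ball c R := by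
  rw [mem_ball_iff_norm] at *
  obtain ⟨h0, h1⟩ := ht
  have hR : 0 < R := (norm_nonneg _).trans_lt hp
  set a := p - c with ha
  set b := q - c with hb
  have hab : a - b = p - q := by simp [ha, hb]
  set u := (1 - t) • a + t • b with hu
  set s := t * (1 - t) * ‖p - q‖ ^ 2 with hs
  have hs0 : 0 ≤ s := by have : 0 ≤ 1 - t := by linarith
                         positivity
  have e1 : arc e p q t - c = u + s • e := by
    simp only [arc, hu, ha, hb, ← hs]; module
  have e2 := norm_sq_segment a b t
  rw [← hu, hab, ← hs] at e2
  have hM : (1 - t) * ‖a‖ ^ 2 + t * ‖b‖ ^ 2 < R ^ 2 := by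
    have ha2 : ‖a‖ ^ 2 < R ^ 2 := by gcongr
    have hb2 : ‖b‖ ^ 2 < R ^ 2 := by gcongr
    rcases eq_or_lt_of_le h0 with rfl | h0
    · simpa using ha2
    · nlinarith
  have hu2 : ‖u‖ ^ 2 < R ^ 2 := by linarith
  have huR : ‖u‖ < R := lt_of_pow_lt_pow_left₀ 2 hR.le hu2
  have hsR : s < R ^ 2 := by nlinarith [sq_nonneg ‖u‖]
  rw [e1]
  refine lt_of_pow_lt_pow_left₀ 2 hR.le ?_
  have h3 : ‖u + s • e‖ ≤ ‖u‖ + s * ‖e‖ := by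
    refine (norm_add_le _ _).trans ?_
    rw [norm_smul, Real.norm_of_nonneg hs0]
  have h4 : ‖u‖ * ‖e‖ ≤ 1 / 3 := (mul_le_mul_of_nonneg_right huR.le (norm_nonneg _)).trans he
  have h5 : s * ‖e‖ ^ 2 ≤ 1 / 9 := by
    have : (R * ‖e‖) ^ 2 ≤ (1 / 3) ^ 2 := by gcongr
    nlinarith [sq_nonneg ‖e‖]
  have h6 : ‖u + s • e‖ ^ 2 ≤ (‖u‖ + s * ‖e‖) ^ 2 := by gcongr
  nlinarith

/-- A set stable under parabolic arcs towards its points in one fixed direction is contractible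
or empty. -/
lemma IsEulerMultiplicative.of_arc {U : Set E} (e : E)
    (h : ∀ p ∈ U, ∀ q ∈ U, ∀ t ∈ Set.Icc (0 : ℝ) 1, arc e p q t ∈ U) :
    IsEulerMultiplicative U := by
  rcases isEmpty_or_nonempty U with hU | ⟨⟨q, hq⟩⟩
  · exact .of_isEmpty
  · have : ContractibleSpace U := by
      rw [contractible_iff_id_nullhomotopic]
      refine ⟨⟨q, hq⟩, ⟨⟨⟨fun x => ⟨arc e x.2 q x.1, h _ x.2.2 _ hq _ x.1.2⟩, ?_⟩, ?_, ?_⟩⟩⟩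
      · exact ((continuous_arc e q).comp (f := fun x : unitInterval × U => ((x.1 : ℝ), (x.2 : E)))
          (by fun_prop)).subtype_mk _
      · intro x; exact Subtype.ext (arc_zero _ _ _)
      · intro x; exact Subtype.ext (arc_one _ _ _)
    exact .of_contractible

/-- A relatively compact open set whose points of the closure have neighbourhoods in which a fixed
family of parabolic arcs stays inside the set. -/
lemma IsEulerMultiplicative.of_locally_arc {Ω : Set E} (ho : IsOpen Ω)
    (hc : IsCompact (closure Ω))
    (hloc : ∀ z ∈ closure Ω, ∃ r > 0, ∃ e : E, ∀ p ∈ Ω ∩ Metric.ball z r,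
      ∀ q ∈ Ω ∩ Metric.ball z r, ∀ t ∈ Set.Icc (0 : ℝ) 1, arc e p q t ∈ Ω) :
    IsEulerMultiplicative Ω := by
  choose! r hr e he using hloc
  obtain ⟨J, hJ, hcov⟩ := hc.elim_nhds_subcover (fun z => Metric.ball z (r z / 2))
    fun z hz => Metric.ball_mem_nhds z (half_pos (hr z hz))
  obtain ⟨l, hl0, hl⟩ : ∃ l > 0, ∀ z ∈ J, ‖e z‖ ≤ l :=
    ⟨∑ z ∈ J, ‖e z‖ + 1, by positivity, fun z hz =>
      (Finset.single_le_sum (f := fun z => ‖e z‖) (fun _ _ => norm_nonneg _) hz).trans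
        (by linarith)⟩
  obtain ⟨ρ, hρ0, hρ⟩ : ∃ ρ > 0, ∀ z ∈ J, ρ ≤ r z / 2 := by
    have : ∀ᶠ ρ in 𝓝[>] (0 : ℝ), ∀ z ∈ J, ρ ≤ r z / 2 := by
      rw [Filter.eventually_all_finset]
      exact fun z hz => (eventually_le_nhds (half_pos (hr z (hJ z hz)))).filter_mono
        nhdsWithin_le_nhds
    obtain ⟨ρ, h1, h2⟩ := (this.and self_mem_nhdsWithin).exists
    exact ⟨ρ, h2, h1⟩
  set R := min ρ (1 / (3 * l)) with hR
  have hR0 : 0 < R := by positivity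
  have hRl : R * l ≤ 1 / 3 := by
    calc R * l ≤ 1 / (3 * l) * l := by gcongr; exact min_le_right _ _
      _ = 1 / 3 := by field_simp
  obtain ⟨C, hCs, hCf, hCc⟩ := hc.finite_cover_balls hR0
  obtain ⟨n, c, hcinj, hrange⟩ := hCf.fin_param
  have e1 : Ω = ⋃ i, Ω ∩ Metric.ball (c i) R := by
    rw [← Set.inter_iUnion, eq_comm, Set.inter_eq_left]
    refine subset_closure.trans (hCc.trans ?_)
    rw [← hrange, Set.biUnion_range]
  rw [e1]
  refine IsEulerMultiplicative.iUnion (G := {U | ∃ B : Set E, IsOpen B ∧ U = Ω ∩ B ∧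
      (∀ e' : E, ‖e'‖ ≤ l → ∀ p ∈ B, ∀ q ∈ B, ∀ t ∈ Set.Icc (0 : ℝ) 1, arc e' p q t ∈ B) ∧
      ∃ e' : E, ‖e'‖ ≤ l ∧ ∀ p ∈ Ω ∩ B, ∀ q ∈ Ω ∩ B, ∀ t ∈ Set.Icc (0 : ℝ) 1, arc e' p q t ∈ Ω})
    ?_ ?_ ?_ n _ ?_
  · rintro U ⟨B, hB, rfl, -⟩
    exact ho.inter hB
  · rintro U ⟨B, hB, rfl, hBc, e', he', hloc⟩ V ⟨B', hB', rfl, hBc', -⟩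
    refine ⟨B ∩ B', hB.inter hB', by ext; simp; tauto, fun d hd p hp q hq t ht =>
      ⟨hBc d hd p hp.1 q hq.1 t ht, hBc' d hd p hp.2 q hq.2 t ht⟩, e', he', fun p hp q hq t ht =>
      hloc p ⟨hp.1, hp.2.1⟩ q ⟨hq.1, hq.2.1⟩ t ht⟩
  · rintro U ⟨B, hB, rfl, hBc, e', he', hloc⟩
    exact .of_arc e' fun p hp q hq t ht => ⟨hloc p hp q hq t ht, hBc e' he' p hp.2 q hq.2 t ht⟩
  · intro i
    refine ⟨_, Metric.isOpen_ball, rfl, fun d hd p hp q hq t ht => arc_mem_ball hp hq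
      ((mul_le_mul_of_nonneg_left hd hR0.le).trans hRl) ht, ?_⟩
    have hci : c i ∈ closure Ω := hCs (hrange ▸ ⟨i, rfl⟩)
    obtain ⟨z, hz, hcz⟩ := Set.mem_iUnion₂.1 (hcov hci)
    have hsub : Metric.ball (c i) R ⊆ Metric.ball z (r z) := by
      refine Metric.ball_subset_ball' ?_
      have := hρ z hz
      have h2 : R ≤ ρ := min_le_left _ _
      rw [Metric.mem_ball] at hcz
      linarith
    exact ⟨e z, hl z hz, fun p hp q hq => he z (hJ z hz) p ⟨hp.1, hsub hp.2⟩ q ⟨hq.1, hsub hq.2⟩⟩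

lemma segment_le_of_lipschitz_fderiv {f : E → ℝ} (hf : ContDiff ℝ 1 f) {s : Set E}
    (hs : Convex ℝ s) {K : NNReal} (hK : LipschitzOnWith K (fderiv ℝ f) s) {p q : E} (hp : p ∈ s)
    (hq : q ∈ s) {t : ℝ} (ht : t ∈ Set.Icc (0 : ℝ) 1) :
    f ((1 - t) • p + t • q) ≤ (1 - t) * f p + t * f q + K * (t * (1 - t) * ‖p - q‖ ^ 2) := by
  set v := q - p with hv
  have hd : ∀ τ : ℝ, HasDerivAt (fun τ : ℝ => f (p + τ • v) + K * ‖v‖ ^ 2 * τ ^ 2)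
      (fderiv ℝ f (p + τ • v) v + K * ‖v‖ ^ 2 * (2 * τ)) τ := by
    intro τ
    have h1 : HasDerivAt (fun τ : ℝ => p + τ • v) v τ := by
      simpa using ((hasDerivAt_id τ).smul_const v).const_add p
    have h2 := ((hf.differentiable one_ne_zero) (p + τ • v)).hasFDerivAt.comp_hasDerivAt τ h1
    have h3 := ((hasDerivAt_pow 2 τ).const_mul (K * ‖v‖ ^ 2))
    refine (h2.add h3).congr_deriv ?_
    simp
  have hmem : ∀ τ ∈ Set.Icc (0 : ℝ) 1, p + τ • v ∈ s := by
    intro τ hτ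
    exact hs.add_smul_sub_mem hp hq hτ
  have hconv : ConvexOn ℝ (Set.Icc (0 : ℝ) 1)
      (fun τ : ℝ => f (p + τ • v) + K * ‖v‖ ^ 2 * τ ^ 2) := by
    refine MonotoneOn.convexOn_of_deriv (convex_Icc 0 1)
      (fun τ _ => (hd τ).continuousAt.continuousWithinAt)
      (fun τ _ => (hd τ).differentiableAt.differentiableWithinAt) ?_
    intro x hx y hy hxy
    rw [(hd x).deriv, (hd y).deriv]
    have hx' := interior_subset hx
    have hy' := interior_subset hy
    have h1 := hK.norm_sub_le (hmem x hx') (hmem y hy')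
    have h2 : p + x • v - (p + y • v) = (x - y) • v := by module
    rw [h2, norm_smul, Real.norm_eq_abs, abs_sub_comm, abs_of_nonneg (sub_nonneg.2 hxy)] at h1
    have h3 : fderiv ℝ f (p + x • v) v - fderiv ℝ f (p + y • v) v ≤ K * ((y - x) * ‖v‖) * ‖v‖ := by
      rw [← _root_.sub_apply]
      refine (Real.le_norm_self _).trans ((ContinuousLinearMap.le_opNorm _ _).trans ?_)
      gcongr
    have h4 : 0 ≤ (K : ℝ) * ‖v‖ ^ 2 * (y - x) := by
      have := sub_nonneg.2 hxy
      positivity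
    nlinarith
  have := hconv.2 (Set.left_mem_Icc.2 zero_le_one) (Set.right_mem_Icc.2 zero_le_one)
    (sub_nonneg.2 ht.2) ht.1 (by ring)
  simp only [smul_eq_mul, mul_zero, mul_one, zero_add, zero_smul, add_zero, one_smul] at this
  have e1 : p + t • v = (1 - t) • p + t • q := by rw [hv]; module
  have e2 : p + v = q := by rw [hv]; abel
  rw [e1, e2] at this
  rw [norm_sub_rev p q, ← hv]
  nlinarith

lemma exists_arc_mem_sublevel {f : E → ℝ} (hf : ContDiff ℝ (⊤ : ℕ∞) f)
    (hreg : ∀ x, f x = 0 → fderiv ℝ f x ≠ 0) {z : E} (hz : z ∈ closure {x | f x < 0}) :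
    ∃ r > 0, ∃ e : E, ∀ p ∈ {x | f x < 0} ∩ Metric.ball z r,
      ∀ q ∈ {x | f x < 0} ∩ Metric.ball z r, ∀ t ∈ Set.Icc (0 : ℝ) 1,
        arc e p q t ∈ {x | f x < 0} := by
  have hz0 : f z ≤ 0 := closure_lt_subset_le hf.continuous continuous_const hz
  have ho : IsOpen {x | f x < 0} := isOpen_lt hf.continuous continuous_const
  rcases hz0.lt_or_eq with hz1 | hz1
  · obtain ⟨r, hr, hb⟩ := Metric.isOpen_iff.1 ho z hz1
    exact ⟨r, hr, 0, fun p hp q hq t ht => hb (arc_mem_ball hp.2 hq.2 (by simp) ht)⟩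
  obtain ⟨w, hw⟩ : ∃ w, fderiv ℝ f z w ≠ 0 := by
    by_contra! h
    exact hreg z hz1 (ContinuousLinearMap.ext h)
  set ν := (fderiv ℝ f z w)⁻¹ • w with hν
  have hν1 : fderiv ℝ f z ν = 1 := by simp [hν, hw]
  have hf1 : ContDiff ℝ 1 f := hf.of_le (by exact_mod_cast le_top)
  have hf' : ContDiff ℝ 1 (fderiv ℝ f) := hf.fderiv_right (by
    have : ((2 : ℕ∞) : WithTop ℕ∞) ≤ ((⊤ : ℕ∞) : WithTop ℕ∞) := by exact_mod_cast le_top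
    rwa [one_add_one_eq_two])
  obtain ⟨K, u, hu, hK⟩ := hf'.contDiffAt.exists_lipschitzOnWith (x := z)
  have hnear : ∀ᶠ x in 𝓝 z, 1 / 2 < fderiv ℝ f x ν := by
    have hcont : Continuous fun x => fderiv ℝ f x ν := hf'.continuous.clm_apply continuous_const
    refine hcont.continuousAt.eventually (lt_mem_nhds ?_)
    change 1 / 2 < fderiv ℝ f z ν
    rw [hν1]; norm_num
  obtain ⟨r₀, hr₀, hb⟩ := Metric.eventually_nhds_iff_ball.1 (hnear.and hu)
  set e := -((2 * K : ℝ) • ν) with he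
  obtain ⟨r, hr, hrr, hre⟩ : ∃ r > 0, r ≤ r₀ ∧ r * ‖e‖ ≤ 1 / 3 := by
    refine ⟨min r₀ (1 / (3 * (‖e‖ + 1))), by positivity, min_le_left _ _, ?_⟩
    calc _ ≤ 1 / (3 * (‖e‖ + 1)) * (‖e‖ + 1) := by
          gcongr
          · exact min_le_right _ _
          · linarith
      _ = 1 / 3 := by
          have : ‖e‖ + 1 ≠ 0 := by positivity
          field_simp
  refine ⟨r, hr, e, fun p hp q hq t ht => ?_⟩
  have hsub : Metric.ball z r ⊆ Metric.ball z r₀ := Metric.ball_subset_ball hrr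
  have hKb : LipschitzOnWith K (fderiv ℝ f) (Metric.ball z r) :=
    hK.mono fun x hx => (hb x (hsub hx)).2
  have h1 := segment_le_of_lipschitz_fderiv hf1 (convex_ball z r) hKb hp.2 hq.2 ht
  have hm := arc_mem_ball hp.2 hq.2 hre ht
  have hm0 : (1 - t) • p + t • q ∈ Metric.ball z r :=
    convex_ball z r hp.2 hq.2 (by linarith [ht.2]) ht.1 (by ring)
  set x := (1 - t) • p + t • q with hx
  set s := t * (1 - t) * ‖p - q‖ ^ 2 with hs
  have hs0 : 0 ≤ s := by
    have := ht.1
    have := sub_nonneg.2 ht.2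
    positivity
  have harc : arc e p q t = x + s • e := rfl
  have hd : ∀ τ : ℝ, HasDerivAt (fun τ : ℝ => f (x + τ • (s • e)))
      (fderiv ℝ f (x + τ • (s • e)) (s • e)) τ := by
    intro τ
    have h1 : HasDerivAt (fun τ : ℝ => x + τ • (s • e)) (s • e) τ := by
      simpa using ((hasDerivAt_id τ).smul_const (s • e)).const_add x
    exact ((hf1.differentiable one_ne_zero) _).hasFDerivAt.comp_hasDerivAt τ h1
  have h2 := (convex_Icc (0 : ℝ) 1).image_sub_le_mul_sub_of_deriv_le
    (f := fun τ : ℝ => f (x + τ • (s • e))) (C := -(K * s))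
    (fun τ _ => (hd τ).continuousAt.continuousWithinAt)
    (fun τ _ => (hd τ).differentiableAt.differentiableWithinAt) (by
      intro τ hτ
      have hτ' := interior_subset hτ
      have hmem : x + τ • (s • e) ∈ Metric.ball z r := by
        have := (convex_ball z r).add_smul_sub_mem hm0 hm hτ'
        rwa [harc, add_sub_cancel_left] at this
      have h3 := (hb _ (hsub hmem)).1
      rw [(hd τ).deriv, he]
      simp only [map_smul, map_neg, smul_eq_mul]
      have : 0 ≤ (K : ℝ) * s := by positivity
      nlinarith) 0 (by simp) 1 (by simp) zero_le_one
  simp only [zero_smul, add_zero, one_smul, sub_zero, mul_one] at h2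
  have hlt : (1 - t) * f p + t * f q < 0 := by
    have hp0 : f p < 0 := hp.1
    have hq0 : f q < 0 := hq.1
    rcases eq_or_lt_of_le ht.1 with rfl | h0
    · simpa using hp0
    · nlinarith [ht.2]
  change f (arc e p q t) < 0
  rw [harc]
  linarith

end GoodCover

section PuncturedDisc

open ContinuousMap Topology

lemma eulerChar_of_contractible {X : Type} [TopologicalSpace X] [ContractibleSpace X] :
    eulerChar X = 1 := by
  rw [eulerChar_congr (ContractibleSpace.hequiv X Unit).some, eulerChar_unit]

lemma eulerChar_union_of_convex {E : Type} [NormedAddCommGroup E] [NormedSpace ℝ E] {U V : Set E}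
    (hU : Convex ℝ U) (hV : Convex ℝ V) (hUo : IsOpen U) (hVo : IsOpen V) (hUn : U.Nonempty)
    (hVn : V.Nonempty) (hd : U ∩ V = ∅) :
    IsEulerMultiplicative ↥(U ∪ V) ∧ eulerChar ↥(U ∪ V) = 2 := by
  have := hU.contractibleSpace hUn
  have := hV.contractibleSpace hVn
  have he : IsEmpty ↥(U ∩ V) := by simp [hd]
  have mI : IsEulerMultiplicative ↥(U ∩ V) := .of_isEmpty
  have mU : IsEulerMultiplicative U := .of_contractible
  have mV : IsEulerMultiplicative V := .of_contractible
  refine ⟨.union hUo hVo mI mU mV, ?_⟩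
  have := (mayerVietoris_union hUo hVo mI.hasFinHomology mV.hasFinHomology).2 mU.hasFinHomology
  rw [eulerChar_of_contractible, eulerChar_of_contractible,
    eulerChar_of_totallyDisconnected (X := ↥(U ∩ V))] at this
  simp at this
  linarith

/-- The open unit disc. -/
abbrev disc : Set (EuclideanSpace ℝ (Fin 2)) := Metric.ball 0 1

/-- The punctured open unit disc. -/
abbrev puncturedDisc : Set (EuclideanSpace ℝ (Fin 2)) := {x ∈ disc | x ≠ 0}

lemma disc_isEulerMultiplicative : IsEulerMultiplicative disc ∧ eulerChar disc = 1 := by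
  have := (convex_ball (0 : EuclideanSpace ℝ (Fin 2)) 1).contractibleSpace
    (Metric.nonempty_ball.2 one_pos)
  exact ⟨.of_contractible, eulerChar_of_contractible⟩

lemma puncturedDisc_isEulerMultiplicative :
    IsEulerMultiplicative puncturedDisc ∧ eulerChar puncturedDisc = 0 := by
  let P (i : Fin 2) : Set (EuclideanSpace ℝ (Fin 2)) := {x ∈ disc | 0 < x i}
  let M (i : Fin 2) : Set (EuclideanSpace ℝ (Fin 2)) := {x ∈ disc | x i < 0}
  have hlin : ∀ i : Fin 2, IsLinearMap ℝ fun x : EuclideanSpace ℝ (Fin 2) => x i :=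
    fun i => ⟨fun _ _ => rfl, fun _ _ => rfl⟩
  have hcont : ∀ i : Fin 2, Continuous fun x : EuclideanSpace ℝ (Fin 2) => x i :=
    fun i => by fun_prop
  have hPc : ∀ i, Convex ℝ (P i) := fun i =>
    (convex_ball _ _).inter (convex_halfSpace_gt (hlin i) 0)
  have hMc : ∀ i, Convex ℝ (M i) := fun i =>
    (convex_ball _ _).inter (convex_halfSpace_lt (hlin i) 0)
  have hPo : ∀ i, IsOpen (P i) := fun i =>
    Metric.isOpen_ball.inter (isOpen_lt continuous_const (hcont i))
  have hMo : ∀ i, IsOpen (M i) := fun i =>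
    Metric.isOpen_ball.inter (isOpen_lt (hcont i) continuous_const)
  have hmem : ∀ a b : ℝ, |a| ≤ 1 / 2 → |b| ≤ 1 / 2 → !₂[a, b] ∈ disc := by
    intro a b ha hb
    rw [mem_ball_zero_iff, EuclideanSpace.norm_eq, Real.sqrt_lt' one_pos]
    have ha2 := sq_le_sq' (abs_le.1 ha).1 (abs_le.1 ha).2
    have hb2 := sq_le_sq' (abs_le.1 hb).1 (abs_le.1 hb).2
    simp [Fin.sum_univ_two]
    linarith
  have key : ∀ V : Set (EuclideanSpace ℝ (Fin 2)), Convex ℝ V → IsOpen V →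
      (∃ b : ℝ, |b| ≤ 1 / 2 ∧ ∀ a : ℝ, |a| ≤ 1 / 2 → !₂[a, b] ∈ V) →
      IsEulerMultiplicative ↥(P 0 ∩ V ∪ M 0 ∩ V) ∧ eulerChar ↥(P 0 ∩ V ∪ M 0 ∩ V) = 2 := by
    rintro V hV hVo ⟨b, hb, hbV⟩
    have h1 : |(1 / 2 : ℝ)| ≤ 1 / 2 := by norm_num [abs_of_pos]
    have h2 : |(-(1 / 2) : ℝ)| ≤ 1 / 2 := by rwa [abs_neg]
    refine eulerChar_union_of_convex ((hPc 0).inter hV) ((hMc 0).inter hV) ((hPo 0).inter hVo)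
      ((hMo 0).inter hVo) ⟨!₂[1 / 2, b], ⟨hmem _ _ h1 hb, by simp⟩, hbV _ h1⟩
      ⟨!₂[-(1 / 2), b], ⟨hmem _ _ h2 hb, by simp⟩, hbV _ h2⟩ ?_
    rw [Set.eq_empty_iff_forall_notMem]
    rintro x ⟨⟨⟨-, h⟩, -⟩, ⟨⟨-, h'⟩, -⟩⟩
    exact lt_asymm h h'
  have hA := key Set.univ convex_univ isOpen_univ ⟨0, by simp, by simp⟩
  have hP := key (P 1) (hPc 1) (hPo 1) ⟨1 / 2, by norm_num [abs_of_pos], fun a ha =>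
    ⟨hmem _ _ ha (by norm_num [abs_of_pos]), by simp⟩⟩
  have hM := key (M 1) (hMc 1) (hMo 1) ⟨-(1 / 2), by norm_num [abs_of_pos],
    fun a ha => ⟨hmem _ _ ha (by norm_num [abs_of_pos]), by simp⟩⟩
  rw [Set.inter_univ, Set.inter_univ] at hA
  have hz : |(0 : ℝ)| ≤ 1 / 2 := by norm_num
  have := (hPc 1).contractibleSpace ⟨!₂[0, 1 / 2],
    hmem _ _ hz (by norm_num [abs_of_pos]), by simp⟩
  have := (hMc 1).contractibleSpace ⟨!₂[0, -(1 / 2)],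
    hmem _ _ hz (by norm_num [abs_of_pos]), by simp⟩
  have mP : IsEulerMultiplicative (P 1) := .of_contractible
  have mM : IsEulerMultiplicative (M 1) := .of_contractible
  have e1 : (P 0 ∪ M 0) ∩ P 1 = P 0 ∩ P 1 ∪ M 0 ∩ P 1 := Set.union_inter_distrib_right _ _ _
  have e2 : (P 0 ∪ M 0 ∪ P 1) ∩ M 1 = P 0 ∩ M 1 ∪ M 0 ∩ M 1 := by
    have : P 1 ∩ M 1 = ∅ := by
      rw [Set.eq_empty_iff_forall_notMem]
      rintro x ⟨⟨-, h⟩, ⟨-, h'⟩⟩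
      exact lt_asymm h h'
    rw [Set.union_inter_distrib_right, this, Set.union_empty, Set.union_inter_distrib_right]
  have e3 : P 0 ∪ M 0 ∪ P 1 ∪ M 1 = puncturedDisc := by
    ext x
    have h0 : x ≠ 0 ↔ x 0 ≠ 0 ∨ x 1 ≠ 0 := by
      rw [Ne, PiLp.ext_iff, Fin.forall_fin_two]
      simp [imp_iff_not_or]
    simp only [P, M, Set.mem_union, Set.mem_ofPred_eq, h0, ne_iff_lt_or_gt]
    tauto
  have hAo := (hPo 0).union (hMo 0)
  rw [← e1] at hP
  rw [← e2] at hM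
  have m1 := IsEulerMultiplicative.union hAo (hPo 1) hP.1 hA.1 mP
  have m2 := IsEulerMultiplicative.union (hAo.union (hPo 1)) (hMo 1) hM.1 m1 mM
  have c1 := (mayerVietoris_union hAo (hPo 1) hP.1.hasFinHomology mP.hasFinHomology).2
    hA.1.hasFinHomology
  have c2 := (mayerVietoris_union (hAo.union (hPo 1)) (hMo 1) hM.1.hasFinHomology
    mM.hasFinHomology).2 m1.hasFinHomology
  rw [hA.2, hP.2, eulerChar_of_contractible] at c1
  rw [hM.2, eulerChar_of_contractible (X := M 1)] at c2
  rw [← e3]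
  exact ⟨m2, by linarith⟩

end PuncturedDisc

section RemoveSection

open ContinuousMap Topology

variable {Y : Type}

/-- A tube of variable radius `ρ` around the graph of `s` with cross-section `W` is a product. -/
noncomputable def tubeHomeomorph [TopologicalSpace Y] {P : Type} [NormedAddCommGroup P]
    [NormedSpace ℝ P] {s : Y → P} (hs : Continuous s) {ρ : Y → ℝ} (hρ : Continuous ρ)
    (hρ0 : ∀ y, ρ y ≠ 0) (W : Set P) :
    {z : Y × P | (ρ z.1)⁻¹ • (z.2 - s z.1) ∈ W} ≃ₜ Y × W where
  toFun z := (z.1.1, ⟨(ρ z.1.1)⁻¹ • (z.1.2 - s z.1.1), z.2⟩)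
  invFun z := ⟨(z.1, s z.1 + ρ z.1 • (z.2 : P)), by simp [smul_smul, hρ0]⟩
  left_inv z := by
    refine Subtype.ext (Prod.ext rfl ?_)
    simp [smul_smul, hρ0]
  right_inv z := by
    refine Prod.ext rfl (Subtype.ext ?_)
    simp [smul_smul, hρ0]
  continuous_toFun := by
    have h1 : Continuous fun z : {z : Y × P | (ρ z.1)⁻¹ • (z.2 - s z.1) ∈ W} => (ρ z.1.1)⁻¹ :=
      (hρ.comp (by fun_prop)).inv₀ fun _ => hρ0 _
    fun_prop
  continuous_invFun := by fun_prop

/-- Removing a section from an open family of plane domains. -/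
lemma eulerChar_remove_section [MetricSpace Y] (hY : HasFinHomology Y)
    {E : Set (Y × EuclideanSpace ℝ (Fin 2))} (hE : IsOpen E) (hfin : HasFinHomology E)
    {s : Y → EuclideanSpace ℝ (Fin 2)} (hs : Continuous s) (hsE : ∀ y, (y, s y) ∈ E)
    (x₀ : EuclideanSpace ℝ (Fin 2)) (hx₀ : ∀ y, (y, x₀) ∉ E) :
    HasFinHomology {z ∈ E | z.2 ≠ s z.1} ∧
      eulerChar {z ∈ E | z.2 ≠ s z.1} = eulerChar E - eulerChar Y := by
  let ρ : Y → ℝ := fun y => Metric.infDist (y, s y) Eᶜ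
  have hρ : Continuous ρ := (Metric.continuous_infDist_pt _).comp (by fun_prop)
  have hρ0 : ∀ y, 0 < ρ y := fun y => by
    refine (hE.isClosed_compl.notMem_iff_infDist_pos ⟨_, hx₀ y⟩).1 ?_
    simpa using hsE y
  have hinv : Continuous fun z : Y × EuclideanSpace ℝ (Fin 2) => (ρ z.1)⁻¹ • (z.2 - s z.1) :=
    ((hρ.comp continuous_fst).inv₀ fun z => (hρ0 _).ne').smul (by fun_prop)
  let S : Set (Y × EuclideanSpace ℝ (Fin 2)) := {z ∈ E | z.2 ≠ s z.1}
  let T : Set (Y × EuclideanSpace ℝ (Fin 2)) := {z | (ρ z.1)⁻¹ • (z.2 - s z.1) ∈ disc}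
  have hT : IsOpen T := Metric.isOpen_ball.preimage hinv
  have hS : IsOpen S := hE.inter (isOpen_ne_fun continuous_snd (hs.comp continuous_fst))
  have hTE : T ⊆ E := by
    rintro ⟨y, x⟩ h
    by_contra hn
    have h1 : ρ y ≤ dist (y, s y) (y, x) := Metric.infDist_le_dist_of_mem hn
    rw [dist_comm, dist_prod_same_left, dist_eq_norm] at h1
    simp only [T, Set.mem_ofPred_eq, mem_ball_zero_iff, norm_smul, norm_inv,
      Real.norm_of_nonneg (hρ0 y).le] at h
    rw [inv_mul_lt_iff₀ (hρ0 y)] at h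
    linarith
  have hST : S ∩ T = {z | (ρ z.1)⁻¹ • (z.2 - s z.1) ∈ puncturedDisc} := by
    ext z
    have h1 : (ρ z.1)⁻¹ • (z.2 - s z.1) ≠ 0 ↔ z.2 ≠ s z.1 := by
      simp [(hρ0 z.1).ne', sub_eq_zero]
    constructor
    · rintro ⟨h, h'⟩
      exact ⟨h', h1.2 h.2⟩
    · rintro ⟨h, h'⟩
      exact ⟨⟨hTE h, h1.1 h'⟩, h⟩
  have hU : S ∪ T = E := by
    refine Set.Subset.antisymm (Set.union_subset (fun z h => h.1) hTE) fun z hz => ?_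
    by_cases h : z.2 = s z.1
    · right
      simp [T, h]
    · exact Or.inl ⟨hz, h⟩
  have e1 := (tubeHomeomorph hs hρ (fun y => (hρ0 y).ne') disc).toHomotopyEquiv
  have e2 := (tubeHomeomorph hs hρ (fun y => (hρ0 y).ne') puncturedDisc).toHomotopyEquiv
  rw [← hST] at e2
  have m1 := disc_isEulerMultiplicative.1 Y hY
  have m2 := puncturedDisc_isEulerMultiplicative.1 Y hY
  have mv := mayerVietoris_union hS hT (.of_homotopyEquiv e2 m2.1) (.of_homotopyEquiv e1 m1.1)
  rw [hU] at mv
  have hSf := mv.1.2 hfin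
  have hc := mv.2 hSf
  rw [eulerChar_congr e2, m2.2, puncturedDisc_isEulerMultiplicative.2, eulerChar_congr e1, m1.2,
    disc_isEulerMultiplicative.2] at hc
  exact ⟨hSf, by change eulerChar S = _; linarith⟩

end RemoveSection

section Configuration

open ContinuousMap Topology

/-- The ordered configuration space of `N` points of `Ω`. -/
abbrev Configuration {P : Type} (Ω : Set P) (N : ℕ) : Type :=
  {w : Fin N → P // (∀ i, w i ∈ Ω) ∧ Function.Injective w}

/-- Configurations of `N` points together with a further point of `Ω`, different from the first `k`
points of the configuration. -/
def partialExtension {P : Type} (Ω : Set P) (N k : ℕ) : Set (Configuration Ω N × P) :=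
  {z | z.2 ∈ Ω ∧ ∀ i : Fin N, (i : ℕ) < k → z.2 ≠ z.1.1 i}

variable {P : Type} [TopologicalSpace P]

lemma continuous_configuration_apply {Ω : Set P} {N : ℕ} (i : Fin N) :
    Continuous fun w : Configuration Ω N => w.1 i :=
  (continuous_apply i).comp continuous_subtype_val

/-- An unconstrained further point gives a product. -/
def partialExtensionZero (Ω : Set P) (N : ℕ) :
    partialExtension Ω N 0 ≃ₜ Configuration Ω N × Ω where
  toFun z := (z.1.1, ⟨z.1.2, z.2.1⟩)
  invFun z := ⟨(z.1, z.2), z.2.2, fun _ h => absurd h (Nat.not_lt_zero _)⟩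
  left_inv _ := rfl
  right_inv _ := rfl
  continuous_toFun := by fun_prop
  continuous_invFun := by fun_prop

/-- A fully constrained further point gives a configuration with one more point. -/
def configurationSucc (Ω : Set P) (N : ℕ) :
    Configuration Ω (N + 1) ≃ₜ partialExtension Ω N N where
  toFun w := ⟨(⟨fun i => w.1 i.castSucc, fun i => w.2.1 _,
      fun _ _ h => Fin.castSucc_injective _ (w.2.2 h)⟩, w.1 (Fin.last N)),
    w.2.1 _, fun i _ h => (Fin.castSucc_lt_last i).ne' (w.2.2 h)⟩
  invFun z := ⟨Fin.snoc z.1.1.1 z.1.2,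
    Fin.lastCases (by simpa using z.2.1) fun i => by simpa using z.1.1.2.1 i,
    Fin.snoc_injective_iff.2 ⟨z.1.1.2.2, by
      rintro ⟨i, hi⟩
      exact z.2.2 i i.2 hi.symm⟩⟩
  left_inv w := Subtype.ext (Fin.snoc_init_self w.1)
  right_inv z := by
    refine Subtype.ext (Prod.ext (Subtype.ext (funext fun i => ?_)) ?_)
    · exact Fin.snoc_castSucc (α := fun _ => P) _ _ i
    · exact Fin.snoc_last (α := fun _ => P) _ _
  continuous_toFun := by
    refine Continuous.subtype_mk (.prodMk (.subtype_mk (continuous_pi fun i => ?_) _) ?_) _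
    · exact continuous_configuration_apply i.castSucc
    · exact continuous_configuration_apply (Fin.last N)
  continuous_invFun := by
    refine Continuous.subtype_mk (continuous_pi fun i => ?_) _
    refine Fin.lastCases ?_ (fun i => ?_) i
    · simp only [Fin.snoc_last]; fun_prop
    · simp only [Fin.snoc_castSucc]
      exact (continuous_configuration_apply i).comp (continuous_fst.comp continuous_subtype_val)

lemma isOpen_partialExtension [T2Space P] {Ω : Set P} (ho : IsOpen Ω) (N k : ℕ) :
    IsOpen (partialExtension Ω N k) := by
  have : partialExtension Ω N k =
      {z | z.2 ∈ Ω} ∩ ⋂ i : Fin N, {z | (i : ℕ) < k → z.2 ≠ z.1.1 i} := by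
    ext; simp [partialExtension]
  rw [this]
  refine (ho.preimage continuous_snd).inter (isOpen_iInter_of_finite fun i => ?_)
  by_cases h : (i : ℕ) < k
  · simp only [h, true_imp_iff]
    exact isOpen_ne_fun continuous_snd ((continuous_configuration_apply i).comp continuous_fst)
  · simp [h]

lemma eulerChar_partialExtension {Ω : Set (EuclideanSpace ℝ (Fin 2))} (ho : IsOpen Ω)
    (hm : IsEulerMultiplicative Ω) {x₀ : EuclideanSpace ℝ (Fin 2)} (hx₀ : x₀ ∉ Ω) {N : ℕ}
    (hN : HasFinHomology (Configuration Ω N)) {k : ℕ} (hk : k ≤ N) :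
    HasFinHomology (partialExtension Ω N k) ∧
      eulerChar (partialExtension Ω N k) =
        eulerChar (Configuration Ω N) * (eulerChar Ω - k) := by
  induction k with
  | zero =>
    have e := (partialExtensionZero Ω N).toHomotopyEquiv
    exact ⟨.of_homotopyEquiv e (hm _ hN).1, by rw [eulerChar_congr e, (hm _ hN).2]; simp⟩
  | succ k ih =>
    obtain ⟨h1, h2⟩ := ih (by omega)
    have hr := eulerChar_remove_section hN (isOpen_partialExtension ho N k) h1
      (s := fun w => w.1 ⟨k, hk⟩) (continuous_configuration_apply _)
      (fun w => ⟨w.2.1 _, fun i hi h => hi.ne' (congrArg Fin.val (w.2.2 h))⟩) x₀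
      (fun w h => hx₀ h.1)
    have e : {z ∈ partialExtension Ω N k | z.2 ≠ z.1.1 ⟨k, hk⟩} = partialExtension Ω N (k + 1) := by
      ext z
      constructor
      · rintro ⟨⟨h, h'⟩, h''⟩
        refine ⟨h, fun i hi => ?_⟩
        rcases (Nat.lt_succ_iff.1 hi).lt_or_eq with h3 | h3
        · exact h' i h3
        · obtain rfl : i = ⟨k, hk⟩ := Fin.ext h3
          exact h''
      · rintro ⟨h, h'⟩
        exact ⟨⟨h, fun i hi => h' i (hi.trans (Nat.lt_succ_self k))⟩,
          h' ⟨k, hk⟩ (Nat.lt_succ_self k)⟩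
    rw [e] at hr
    refine ⟨hr.1, ?_⟩
    rw [hr.2, h2]
    push_cast
    ring

lemma eulerChar_configuration {Ω : Set (EuclideanSpace ℝ (Fin 2))} (ho : IsOpen Ω)
    (hm : IsEulerMultiplicative Ω) {x₀ : EuclideanSpace ℝ (Fin 2)} (hx₀ : x₀ ∉ Ω) (N : ℕ) :
    HasFinHomology (Configuration Ω N) ∧
      eulerChar (Configuration Ω N) = ∏ k ∈ Finset.range N, (eulerChar Ω - (k : ℤ)) := by
  induction N with
  | zero =>
    have : Unique (Configuration Ω 0) :=
      ⟨⟨⟨Fin.elim0, fun i => i.elim0, fun i => i.elim0⟩⟩,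
        fun w => Subtype.ext (funext fun i => i.elim0)⟩
    exact ⟨.of_totallyDisconnected, by simp [eulerChar_of_totallyDisconnected]⟩
  | succ N ih =>
    have e := (configurationSucc Ω N).toHomotopyEquiv
    have h := eulerChar_partialExtension ho hm hx₀ ih.1 le_rfl
    exact ⟨.of_homotopyEquiv e h.1, by
      rw [eulerChar_congr e, h.2, ih.2, Finset.prod_range_succ]⟩

end Configuration

/-- For a smoothly bounded domain `Ω ⊂ ℝ²` (a bounded connected open set which is the
sublevel set of a smooth function having `0` as a regular value), the Euler characteristic
of the ordered configuration space `F(Ω,N) = {(x₁,…,x_N) ∈ Ω^N : x_i ≠ x_j for i ≠ j}`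
equals `χ(Ω)(χ(Ω)−1)⋯(χ(Ω)−N+1)`. -/
theorem eulerChar_configuration_space
    (Ω : Set (EuclideanSpace ℝ (Fin 2)))
    (hopen : IsOpen Ω) (hconn : IsConnected Ω)
    (hbound : Bornology.IsBounded Ω)
    (hsmooth : ∃ f : EuclideanSpace ℝ (Fin 2) → ℝ, ContDiff ℝ (⊤ : ℕ∞) f ∧
      Ω = {x | f x < 0} ∧ ∀ x, f x = 0 → fderiv ℝ f x ≠ 0)
    (N : ℕ) (hN : 0 < N) :
    eulerChar {w : Fin N → EuclideanSpace ℝ (Fin 2) //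
        (∀ i, w i ∈ Ω) ∧ Function.Injective w} =
      ∏ k ∈ Finset.range N, (eulerChar Ω - (k : ℤ)) := by
  obtain ⟨f, hf, hΩ, hreg⟩ := hsmooth
  have hm : IsEulerMultiplicative Ω := by
    refine .of_locally_arc hopen hbound.isCompact_closure ?_
    rw [hΩ]
    exact fun z hz => exists_arc_mem_sublevel hf hreg hz
  obtain ⟨x₀, hx₀⟩ : ∃ x₀, x₀ ∉ Ω := by
    by_contra! h
    exact NormedSpace.unbounded_univ ℝ (EuclideanSpace ℝ (Fin 2))
      (hbound.subset fun x _ => h x)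
  exact (eulerChar_configuration hopen hm hx₀ N).2
end

section
/- Let Ω ⊂ ℝ² be a bounded domain, λ₁ the first Dirichlet eigenvalue of the (nonnegative) Laplacian on Ω, p ∈ [1,2], λ > 0, and suppose u is a positive smooth solution of Δu = pλ u^{p−1} e^{u^p} in Ω with u = 0 on ∂Ω. Then 2λ ≤ λ₁. -/
/-- The (nonnegative) geometer's Laplacian `Δ = −∂_xx − ∂_yy` on functions of two real
variables. -/
noncomputable def negLap (u : EuclideanSpace ℝ (Fin 2) → ℝ)
    (x : EuclideanSpace ℝ (Fin 2)) : ℝ :=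
  - ∑ i : Fin 2,
      fderiv ℝ (fun y => fderiv ℝ u y (EuclideanSpace.single i 1)) x
        (EuclideanSpace.single i 1)

open MeasureTheory Filter Topology

/-- The elementary inequality `2 t ≤ p t^(p-1) e^(t^p)`. -/
lemma two_mul_le_mul_rpow_mul_exp_rpow {p t : ℝ} (hp : p ∈ Set.Icc (1 : ℝ) 2) (ht : 0 < t) :
    2 * t ≤ p * t ^ (p - 1) * Real.exp (t ^ p) := by
  obtain ⟨hp1, hp2⟩ := hp
  have hp0 : 0 < p := by linarith
  set s := t ^ p with hs
  have hs0 : 0 < s := Real.rpow_pos_of_pos ht p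
  have hq : t ^ (2 - p) = s ^ ((2 - p) / p) := by
    rw [hs, ← Real.rpow_mul ht.le]
    congr 1
    field_simp
  have hamgm : s ^ ((2 - p) / p) ≤ 1 + (2 - p) / p * (s - 1) := by
    have := rpow_one_add_le_one_add_mul_self (s := s - 1) (by linarith)
      (p := (2 - p) / p) (div_nonneg (by linarith) hp0.le)
      (by rw [div_le_one hp0]; linarith)
    simpa using this
  have hexp : 1 + s + s ^ 2 / 2 ≤ Real.exp s := Real.quadratic_le_exp_of_nonneg hs0.le
  have hpoly : 2 * (1 + (2 - p) / p * (s - 1)) ≤ p * (1 + s + s ^ 2 / 2) := by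
    have : 2 * (1 + (2 - p) / p * (s - 1)) = (4 * (p - 1) + 2 * (2 - p) * s) / p := by
      field_simp; ring
    rw [this, div_le_iff₀ hp0]
    nlinarith [sq_nonneg (2 - p - p * s), mul_nonneg (sub_nonneg.2 hp1) hs0.le,
      sq_nonneg (2 - p)]
  have hmain : 2 * t ^ (2 - p) ≤ p * Real.exp s := by
    rw [hq]
    nlinarith [mul_le_mul_of_nonneg_left hexp hp0.le]
  have ht2 : t = t ^ (p - 1) * t ^ (2 - p) := by
    rw [← Real.rpow_add ht]; norm_num
  calc 2 * t = t ^ (p - 1) * (2 * t ^ (2 - p)) := by linarith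
    _ ≤ t ^ (p - 1) * (p * Real.exp s) := by gcongr
    _ = _ := by ring

/-- A function that is constant below `a`, with vanishing derivative at `a`, glues to a
differentiable function. -/
lemma hasDerivAt_comp_max {g g' : ℝ → ℝ} {a : ℝ} (hg : ∀ t, a ≤ t → HasDerivAt g (g' t) t)
    (hga : g' a = 0) (t : ℝ) : HasDerivAt (fun t => g (max t a)) (g' (max t a)) t := by
  rcases lt_trichotomy t a with h | rfl | h
  · rw [max_eq_right h.le, hga]
    refine (hasDerivAt_const t (g a)).congr_of_eventuallyEq ?_
    filter_upwards [eventually_lt_nhds h] with s hs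
    rw [max_eq_right hs.le]
  · rw [max_self, ← hasDerivWithinAt_univ, ← Set.Iic_union_Ici (a := t)]
    refine HasDerivWithinAt.union ?_ ?_
    · rw [hga]
      refine (hasDerivWithinAt_const t _ (g t)).congr (fun s hs => ?_) (by simp)
      rw [max_eq_right (Set.mem_Iic.1 hs)]
    · refine (hg t le_rfl).hasDerivWithinAt.congr (fun s hs => ?_) (by simp)
      rw [max_eq_left (Set.mem_Ici.1 hs)]
  · rw [max_eq_left h.le]
    refine (hg t h.le).congr_of_eventuallyEq ?_
    filter_upwards [eventually_gt_nhds h] with s hs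
    rw [max_eq_left hs.le]

/-- Truncations `φ`, `Φ` of the identity, vanishing below `ε`, with `Φ' = (φ')²`. -/
lemma exists_truncation {ε : ℝ} (hε : 0 < ε) :
    ∃ φ φ' Φ : ℝ → ℝ, (∀ t, HasDerivAt φ (φ' t) t) ∧ (∀ t, HasDerivAt Φ (φ' t ^ 2) t) ∧
      Continuous φ' ∧ (∀ t ≤ ε, φ t = 0) ∧ (∀ t ≤ ε, Φ t = 0) ∧
      (∀ t, 0 ≤ t → t * Φ t ≤ t ^ 2) ∧ (∀ t, 0 ≤ t → t ^ 2 - 4 * ε * t ≤ φ t ^ 2) := by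
  refine ⟨fun t => (fun s => s - 2 * ε + ε ^ 2 * s⁻¹) (max t ε),
    fun t => (fun s => 1 - ε ^ 2 * (s ^ 2)⁻¹) (max t ε),
    fun t => (fun s => s + 2 * ε ^ 2 * s⁻¹ - ε ^ 4 / 3 * (s ^ 3)⁻¹ - 8 * ε / 3) (max t ε),
    ?_, ?_, ?_, ?_, ?_, ?_, ?_⟩
  · refine hasDerivAt_comp_max (a := ε) (g := fun s => s - 2 * ε + ε ^ 2 * s⁻¹)
      (g' := fun s => 1 - ε ^ 2 * (s ^ 2)⁻¹) (fun t ht => ?_) ?_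
    · have ht0 : t ≠ 0 := (hε.trans_le ht).ne'
      refine HasDerivAt.congr_deriv (((hasDerivAt_id t).sub_const (2 * ε)).add
        ((hasDerivAt_inv ht0).const_mul (ε ^ 2))) ?_
      ring
    · field_simp; ring
  · refine hasDerivAt_comp_max (a := ε)
      (g := fun s => s + 2 * ε ^ 2 * s⁻¹ - ε ^ 4 / 3 * (s ^ 3)⁻¹ - 8 * ε / 3)
      (g' := fun s => (1 - ε ^ 2 * (s ^ 2)⁻¹) ^ 2) (fun t ht => ?_) ?_
    · have ht0 : t ≠ 0 := (hε.trans_le ht).ne'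
      refine HasDerivAt.congr_deriv ((((hasDerivAt_id t).add ((hasDerivAt_inv ht0).const_mul (2 * ε ^ 2))).sub
        (((hasDerivAt_pow 3 t).inv (pow_ne_zero 3 ht0)).const_mul (ε ^ 4 / 3))).sub_const
          (8 * ε / 3)) ?_
      push_cast
      field_simp
      ring
    · field_simp; ring
  · have h : ∀ t, max t ε ^ 2 ≠ 0 := fun t => by positivity
    fun_prop (disch := exact h _)
  · intro t ht
    simp only [max_eq_right ht]
    field_simp; ring
  · intro t ht
    simp only [max_eq_right ht]
    field_simp; ring
  · intro t ht0
    rw [sq t]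
    refine mul_le_mul_of_nonneg_left ?_ ht0
    rcases le_total t ε with h | h
    · simp only [max_eq_right h]
      have : ε + 2 * ε ^ 2 * ε⁻¹ - ε ^ 4 / 3 * (ε ^ 3)⁻¹ - 8 * ε / 3 = 0 := by field_simp; ring
      linarith
    · simp only [max_eq_left h]
      have ht : 0 < t := hε.trans_le h
      have h1 : ε ^ 2 * t⁻¹ ≤ ε := by
        rw [← div_eq_mul_inv, div_le_iff₀ ht]; nlinarith
      have h2 : 0 ≤ ε ^ 4 / 3 * (t ^ 3)⁻¹ := by positivity
      linarith
  · intro t ht0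
    rcases le_total t (2 * ε) with h | h
    · nlinarith [sq_nonneg ((fun s => s - 2 * ε + ε ^ 2 * s⁻¹) (max t ε))]
    · simp only [max_eq_left (show ε ≤ t by linarith)]
      have ht : 0 < t := by linarith
      have h2 : 0 ≤ ε ^ 2 * t⁻¹ := by positivity
      nlinarith

lemma integral_fderiv_apply_eq_zero {E : Type*} [NormedAddCommGroup E] [NormedSpace ℝ E]
    [FiniteDimensional ℝ E] [MeasurableSpace E] [BorelSpace E] (μ : Measure E)
    [μ.IsAddHaarMeasure] {F : E → ℝ} (hF : ContDiff ℝ 1 F) (hc : HasCompactSupport F) (e : E) :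
    Integrable (fun x => fderiv ℝ F x e) μ ∧ ∫ x, fderiv ℝ F x e ∂μ = 0 := by
  have hint : Integrable (fun x => fderiv ℝ F x e) μ :=
    ((hF.continuous_fderiv one_ne_zero).clm_apply continuous_const).integrable_of_hasCompactSupport
      (hc.fderiv_apply ℝ e)
  refine ⟨hint, ?_⟩
  have := integral_mul_fderiv_eq_neg_fderiv_mul_of_integrable (μ := μ) (f := fun _ : E => (1 : ℝ))
    (g := F) (v := e) (by simp) (by simpa using hint)
    (by simpa using hF.continuous.integrable_of_hasCompactSupport hc)
    (fun x _ => differentiableAt_const _) (fun x _ => hF.differentiable one_ne_zero x)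
  simpa using this

/-- Extension by zero of a `C¹` function on an open set `Ω` vanishing off a closed `K ⊆ Ω`. -/
lemma contDiff_indicator {E : Type*} [NormedAddCommGroup E] [NormedSpace ℝ E] {Ω K : Set E}
    (hΩ : IsOpen Ω) (hK : IsClosed K) (hKΩ : K ⊆ Ω) {G : E → ℝ} (hG : ContDiffOn ℝ 1 G Ω)
    (hG0 : ∀ x ∈ Ω, x ∉ K → G x = 0) : ContDiff ℝ 1 (Ω.indicator G) := by
  rw [contDiff_iff_contDiffAt]
  intro x
  by_cases hx : x ∈ K
  · have hxΩ : Ω ∈ 𝓝 x := hΩ.mem_nhds (hKΩ hx)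
    refine (hG.contDiffAt hxΩ).congr_of_eventuallyEq ?_
    filter_upwards [hxΩ] with y hy using Set.indicator_of_mem hy G
  · refine (contDiffAt_const (c := (0 : ℝ))).congr_of_eventuallyEq ?_
    filter_upwards [hK.isOpen_compl.mem_nhds hx] with y hy
    by_cases hyΩ : y ∈ Ω
    · rw [Set.indicator_of_mem hyΩ, hG0 y hyΩ hy]
    · exact Set.indicator_of_notMem hyΩ G

/-- The derivative of the Picone-type field `φ(v)² ∂u / u - Φ(v) ∂v` when `Φ' = (φ')²`. -/
lemma fderiv_picone_field_le {E : Type*} [NormedAddCommGroup E] [NormedSpace ℝ E]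
    {u v du dv : E → ℝ} {φ φ' Φ : ℝ → ℝ} {x e : E}
    (hφ : HasDerivAt φ (φ' (v x)) (v x)) (hΦ : HasDerivAt Φ (φ' (v x) ^ 2) (v x))
    (hu : DifferentiableAt ℝ u x) (hv : DifferentiableAt ℝ v x)
    (hdu : DifferentiableAt ℝ du x) (hdv : DifferentiableAt ℝ dv x)
    (hdux : du x = fderiv ℝ u x e) (hdvx : dv x = fderiv ℝ v x e) (hux : u x ≠ 0) :
    fderiv ℝ (fun y => φ (v y) ^ 2 * (du y * (u y)⁻¹) - Φ (v y) * dv y) x e ≤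
      φ (v x) ^ 2 / u x * fderiv ℝ du x e - Φ (v x) * fderiv ℝ dv x e := by
  have h1 := hφ.comp_hasFDerivAt x hv.hasFDerivAt
  have h2 := hΦ.comp_hasFDerivAt x hv.hasFDerivAt
  have h3 := (hasDerivAt_inv hux).comp_hasFDerivAt x hu.hasFDerivAt
  have h := ((h1.pow 2).mul (hdu.hasFDerivAt.mul h3)).sub (h2.mul hdv.hasFDerivAt)
  have h' : HasFDerivAt (fun y => φ (v y) ^ 2 * (du y * (u y)⁻¹) - Φ (v y) * dv y) _ x := h
  rw [h'.fderiv]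
  simp only [add_apply, sub_apply,
    smul_apply, smul_eq_mul, Function.comp_apply, Pi.mul_apply,
    ← hdux, ← hdvx, nsmul_eq_mul]
  have := sq_nonneg (φ' (v x) * dv x - φ (v x) * du x * (u x)⁻¹)
  norm_num
  rw [div_eq_mul_inv, ← inv_pow]
  nlinarith

/-- Integrated Picone inequality for the truncation of `v` at level `ε`. -/
lemma setIntegral_picone_nonneg {Ω : Set (EuclideanSpace ℝ (Fin 2))} (hΩ : IsOpen Ω)
    (hbdd : Bornology.IsBounded Ω) {u v : EuclideanSpace ℝ (Fin 2) → ℝ} {lam₁ μ : ℝ}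
    (hvcont : ContinuousOn v (closure Ω)) (hv : ContDiffOn ℝ 2 v Ω)
    (hvpos : ∀ x ∈ Ω, 0 < v x) (hvbd : ∀ x ∈ frontier Ω, v x = 0)
    (hveig : ∀ x ∈ Ω, negLap v x = lam₁ * v x) (hlam₁ : 0 ≤ lam₁) (hμ : 0 ≤ μ)
    (hu : ContDiffOn ℝ 2 u Ω) (hupos : ∀ x ∈ Ω, 0 < u x)
    (husup : ∀ x ∈ Ω, μ * u x ≤ negLap u x) {ε : ℝ} (hε : 0 < ε) :
    0 ≤ ∫ x in Ω, (lam₁ * v x ^ 2 - μ * (v x ^ 2 - 4 * ε * v x)) := by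
  obtain ⟨φ, φ', Φ, hφ, hΦ, hφ'c, hφ0, hΦ0, hΦle, hφge⟩ := exists_truncation hε
  have hφC : ContDiff ℝ 1 φ := contDiff_one_iff_deriv.2
    ⟨fun t => (hφ t).differentiableAt, by rwa [funext fun t => (hφ t).deriv]⟩
  have hΦC : ContDiff ℝ 1 Φ := contDiff_one_iff_deriv.2
    ⟨fun t => (hΦ t).differentiableAt, by
      rw [funext fun t => (hΦ t).deriv]; exact hφ'c.pow 2⟩
  have hclosure : IsCompact (closure Ω) := hbdd.isCompact_closure
  let K : Set (EuclideanSpace ℝ (Fin 2)) := closure Ω ∩ v ⁻¹' Set.Ici ε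
  have hKclosed : IsClosed K := hvcont.preimage_isClosed_of_isClosed isClosed_closure isClosed_Ici
  have hKcompact : IsCompact K := hclosure.of_isClosed_subset hKclosed Set.inter_subset_left
  have hKΩ : K ⊆ Ω := by
    rintro x ⟨hx, hxε⟩
    by_contra hxΩ
    have : v x = 0 := hvbd x ⟨hx, by rwa [hΩ.interior_eq]⟩
    have hxε' : ε ≤ v x := hxε
    linarith
  have hvK : ∀ x ∈ Ω, x ∉ K → v x ≤ ε := fun x hx hxK => by
    by_contra! h
    exact hxK ⟨subset_closure hx, h.le⟩
  have hdC : ∀ {w : EuclideanSpace ℝ (Fin 2) → ℝ} (i : Fin 2), ContDiffOn ℝ 2 w Ω →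
      ContDiffOn ℝ 1 (fun y => fderiv ℝ w y (EuclideanSpace.single i 1)) Ω := fun i hw =>
    (hw.fderiv_of_isOpen hΩ (by norm_num)).clm_apply contDiffOn_const
  let G : Fin 2 → EuclideanSpace ℝ (Fin 2) → ℝ := fun i y =>
    φ (v y) ^ 2 * (fderiv ℝ u y (EuclideanSpace.single i 1) * (u y)⁻¹) -
      Φ (v y) * fderiv ℝ v y (EuclideanSpace.single i 1)
  have hv1 : ContDiffOn ℝ 1 v Ω := hv.of_le (by norm_num)
  have hu1 : ContDiffOn ℝ 1 u Ω := hu.of_le (by norm_num)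
  have hGC : ∀ i, ContDiffOn ℝ 1 (G i) Ω := fun i =>
    (((hφC.comp_contDiffOn hv1).pow 2).mul
      ((hdC i hu).mul (hu1.inv fun x hx => (hupos x hx).ne'))).sub
      ((hΦC.comp_contDiffOn hv1).mul (hdC i hv))
  have hG0 : ∀ i, ∀ x ∈ Ω, x ∉ K → G i x = 0 := fun i x hx hxK => by
    simp [G, hφ0 _ (hvK x hx hxK), hΦ0 _ (hvK x hx hxK)]
  let F : Fin 2 → EuclideanSpace ℝ (Fin 2) → ℝ := fun i => Ω.indicator (G i)
  have hFC : ∀ i, ContDiff ℝ 1 (F i) := fun i =>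
    contDiff_indicator hΩ hKclosed hKΩ (hGC i) (hG0 i)
  have hF0 : ∀ i, ∀ x ∉ K, F i x = 0 := fun i x hx => by
    by_cases hxΩ : x ∈ Ω
    · exact (Set.indicator_of_mem hxΩ _).trans (hG0 i x hxΩ hx)
    · exact Set.indicator_of_notMem hxΩ _
  have hFsupp : ∀ i, HasCompactSupport (F i) := fun i => HasCompactSupport.intro hKcompact (hF0 i)
  have hint := fun i => integral_fderiv_apply_eq_zero volume (hFC i) (hFsupp i)
    (EuclideanSpace.single i 1)
  have hdiv0 : ∫ x, ∑ i, fderiv ℝ (F i) x (EuclideanSpace.single i 1) = 0 := by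
    rw [integral_finsetSum _ fun i _ => (hint i).1]
    exact Finset.sum_eq_zero fun i _ => (hint i).2
  have hdivoff : ∀ x ∉ Ω, ∑ i, fderiv ℝ (F i) x (EuclideanSpace.single i 1) = 0 := by
    refine fun x hx => Finset.sum_eq_zero fun i _ => ?_
    have : F i =ᶠ[𝓝 x] fun _ => 0 := by
      filter_upwards [hKclosed.isOpen_compl.mem_nhds fun h => hx (hKΩ h)] with y hy
      exact hF0 i y hy
    simp [this.fderiv_eq]
  rw [← hdiv0, ← setIntegral_eq_integral_of_forall_compl_eq_zero hdivoff]
  refine setIntegral_mono_on (integrable_finsetSum _ fun i _ => (hint i).1).integrableOn ?_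
    hΩ.measurableSet fun x hx => ?_
  · have : ContinuousOn (fun x => lam₁ * v x ^ 2 - μ * (v x ^ 2 - 4 * ε * v x)) (closure Ω) := by
      fun_prop
    exact (this.integrableOn_compact hclosure).mono_set subset_closure
  · have hxΩ : Ω ∈ 𝓝 x := hΩ.mem_nhds hx
    have hdiff : ∀ {w : EuclideanSpace ℝ (Fin 2) → ℝ}, ContDiffOn ℝ 1 w Ω →
        DifferentiableAt ℝ w x := fun hw => (hw.contDiffAt hxΩ).differentiableAt one_ne_zero
    have hle : ∀ i, fderiv ℝ (F i) x (EuclideanSpace.single i 1) ≤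
        φ (v x) ^ 2 / u x * fderiv ℝ (fun y => fderiv ℝ u y (EuclideanSpace.single i 1)) x
          (EuclideanSpace.single i 1) -
        Φ (v x) * fderiv ℝ (fun y => fderiv ℝ v y (EuclideanSpace.single i 1)) x
          (EuclideanSpace.single i 1) := fun i => by
      have heq : F i =ᶠ[𝓝 x] G i := by
        filter_upwards [hxΩ] with y hy using Set.indicator_of_mem hy _
      rw [heq.fderiv_eq]
      exact fderiv_picone_field_le (hφ _) (hΦ _) (hdiff hu1) (hdiff hv1) (hdiff (hdC i hu))
        (hdiff (hdC i hv)) rfl rfl (hupos x hx).ne'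
    refine (Finset.sum_le_sum fun i _ => hle i).trans ?_
    rw [Finset.sum_sub_distrib, ← Finset.mul_sum, ← Finset.mul_sum]
    have hvx := hveig x hx
    have hux := husup x hx
    rw [negLap] at hvx hux
    have hsupx : μ * φ (v x) ^ 2 ≤ φ (v x) ^ 2 / u x * (- ∑ i : Fin 2,
        fderiv ℝ (fun y => fderiv ℝ u y (EuclideanSpace.single i 1)) x
          (EuclideanSpace.single i 1)) := by
      have hu0 := hupos x hx
      calc μ * φ (v x) ^ 2 = φ (v x) ^ 2 / u x * (μ * u x) := by field_simp
        _ ≤ _ := by gcongr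
    rw [neg_eq_iff_eq_neg] at hvx
    rw [hvx]
    nlinarith [mul_le_mul_of_nonneg_left (hΦle _ (hvpos x hx).le) hlam₁,
      mul_le_mul_of_nonneg_left (hφge _ (hvpos x hx).le) hμ]

/-- Barta's bound: a positive supersolution `Δu ≥ μ u` forces `μ ≤ λ₁`. -/
lemma le_eigenvalue_of_supersolution {Ω : Set (EuclideanSpace ℝ (Fin 2))} (hΩ : IsOpen Ω)
    (hbdd : Bornology.IsBounded Ω) (hne : Ω.Nonempty) {u v : EuclideanSpace ℝ (Fin 2) → ℝ}
    {lam₁ μ : ℝ}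
    (hvcont : ContinuousOn v (closure Ω)) (hv : ContDiffOn ℝ 2 v Ω)
    (hvpos : ∀ x ∈ Ω, 0 < v x) (hvbd : ∀ x ∈ frontier Ω, v x = 0)
    (hveig : ∀ x ∈ Ω, negLap v x = lam₁ * v x) (hlam₁ : 0 ≤ lam₁) (hμ : 0 ≤ μ)
    (hu : ContDiffOn ℝ 2 u Ω) (hupos : ∀ x ∈ Ω, 0 < u x)
    (husup : ∀ x ∈ Ω, μ * u x ≤ negLap u x) : μ ≤ lam₁ := by
  have hIv : IntegrableOn v Ω :=
    (hvcont.integrableOn_compact hbdd.isCompact_closure).mono_set subset_closure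
  have hIv2 : IntegrableOn (fun x => v x ^ 2) Ω :=
    ((hvcont.pow 2).integrableOn_compact hbdd.isCompact_closure).mono_set subset_closure
  have hpos : 0 < ∫ x in Ω, v x ^ 2 := by
    rw [setIntegral_pos_iff_support_of_nonneg_ae (ae_of_all _ fun x => sq_nonneg (v x)) hIv2]
    have : Ω ⊆ Function.support (fun x => v x ^ 2) ∩ Ω := fun x hx =>
      ⟨pow_ne_zero 2 (hvpos x hx).ne', hx⟩
    exact (hΩ.measure_pos volume hne).trans_le (measure_mono this)
  have key : ∀ ε > 0, (μ - lam₁) * ∫ x in Ω, v x ^ 2 ≤ (4 * μ * ∫ x in Ω, v x) * ε := by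
    intro ε hε
    have h := setIntegral_picone_nonneg hΩ hbdd hvcont hv hvpos hvbd hveig hlam₁ hμ hu hupos
      husup hε
    have heq : ∫ x in Ω, (lam₁ * v x ^ 2 - μ * (v x ^ 2 - 4 * ε * v x)) =
        (lam₁ - μ) * (∫ x in Ω, v x ^ 2) + 4 * μ * ε * ∫ x in Ω, v x := by
      rw [← integral_const_mul, ← integral_const_mul,
        ← integral_add (hIv2.const_mul _) (hIv.const_mul _)]
      congr 1
      ext x
      ring
    rw [heq] at h
    linarith
  have hlim : Tendsto (fun ε => (4 * μ * ∫ x in Ω, v x) * ε) (𝓝[>] 0) (𝓝 0) := by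
    have : Tendsto (fun ε => (4 * μ * ∫ x in Ω, v x) * ε) (𝓝 0)
        (𝓝 ((4 * μ * ∫ x in Ω, v x) * 0)) := tendsto_id.const_mul _
    rw [mul_zero] at this
    exact this.mono_left nhdsWithin_le_nhds
  have hle := ge_of_tendsto hlim (eventually_mem_nhdsWithin.mono key)
  by_contra! hlt
  exact absurd hle (not_le.2 (mul_pos (sub_pos.2 hlt) hpos))

/-- If `λ₁` is the first Dirichlet eigenvalue of `Δ` on a bounded domain `Ω ⊂ ℝ²`
(characterized by a positive eigenfunction `v₁` and minimality among Dirichlet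
eigenvalues), `p ∈ [1,2]`, `λ > 0`, and `u` is a positive smooth solution of
`Δu = pλ u^(p−1) e^(u^p)` in `Ω` with `u = 0` on `∂Ω`, then `2λ ≤ λ₁`. -/
theorem first_eigenvalue_bound
    (Ω : Set (EuclideanSpace ℝ (Fin 2))) (hopen : IsOpen Ω)
    (hbdd : Bornology.IsBounded Ω) (hne : Ω.Nonempty)
    (lam₁ : ℝ) (v₁ : EuclideanSpace ℝ (Fin 2) → ℝ)
    (hv₁cont : ContinuousOn v₁ (closure Ω)) (hv₁smooth : ContDiffOn ℝ (⊤ : ℕ∞) v₁ Ω)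
    (hv₁pos : ∀ x ∈ Ω, 0 < v₁ x) (hv₁bd : ∀ x ∈ frontier Ω, v₁ x = 0)
    (hv₁eig : ∀ x ∈ Ω, negLap v₁ x = lam₁ * v₁ x) (hlam₁pos : 0 < lam₁)
    (hmin : ∀ (μ : ℝ) (w : EuclideanSpace ℝ (Fin 2) → ℝ),
      ContinuousOn w (closure Ω) → ContDiffOn ℝ (⊤ : ℕ∞) w Ω → (∃ x ∈ Ω, w x ≠ 0) →
      (∀ x ∈ frontier Ω, w x = 0) → (∀ x ∈ Ω, negLap w x = μ * w x) → lam₁ ≤ μ)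
    (p : ℝ) (hp : p ∈ Set.Icc (1 : ℝ) 2) (lam : ℝ) (hlam : 0 < lam)
    (u : EuclideanSpace ℝ (Fin 2) → ℝ)
    (hucont : ContinuousOn u (closure Ω)) (husmooth : ContDiffOn ℝ (⊤ : ℕ∞) u Ω)
    (hupos : ∀ x ∈ Ω, 0 < u x) (hubd : ∀ x ∈ frontier Ω, u x = 0)
    (hueq : ∀ x ∈ Ω, negLap u x = p * lam * u x ^ (p - 1) * Real.exp (u x ^ p)) :
    2 * lam ≤ lam₁ := by
  obtain ⟨hp1, hp2⟩ := hp
  refine le_eigenvalue_of_supersolution hopen hbdd hne hv₁cont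
    (hv₁smooth.of_le (WithTop.coe_le_coe.2 le_top)) hv₁pos hv₁bd
    hv₁eig hlam₁pos.le (by positivity) (husmooth.of_le (WithTop.coe_le_coe.2 le_top)) hupos
    fun x hx => ?_
  rw [hueq x hx]
  nlinarith [mul_le_mul_of_nonneg_left
    (two_mul_le_mul_rpow_mul_exp_rpow ⟨hp1, hp2⟩ (hupos x hx)) hlam.le]
end
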